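/- The algebra of P_I-invariants (S(V)⊗Λ(V))^{P_I} is a free module of rank 2^n over the invariant ring S(V)^{P_I}, with basis consisting of 1 together with the elements M_{m_i;b_1,…,b_j}·θ_1^{q−2}θ_2^{q−2}⋯θ_i^{q−2} for all 1 ≤ i ≤ ℓ, 1 ≤ j ≤ m_i and integer sequences 0 ≤ b_1 < b_2 < ⋯ < b_j ≤ m_i−1 with b_j ≥ m_{i−1}. -/

import Mathlib

open scoped TensorProduct
open MvPolynomial Finset

noncomputable section

/-- The symmetric algebra `S(V) = F[x_1,…,x_n]` of the natural module `V = F^n`. -/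
abbrev SV (F : Type) [Field F] (n : ℕ) := MvPolynomial (Fin n) F

/-- The exterior algebra `Λ(V) = E[y_1,…,y_n]`. -/
abbrev LV (F : Type) [Field F] (n : ℕ) := ExteriorAlgebra F (Fin n → F)

/-- `S(V) ⊗ Λ(V)`. -/
abbrev SL (F : Type) [Field F] (n : ℕ) := SV F n ⊗[F] LV F n

/-- the variable `x_{a+1}` (0-indexed `a`), junk value `0` out of range. -/
def xV (F : Type) [Field F] (n a : ℕ) : SV F n :=
  if h : a < n then X ⟨a, h⟩ else 0

/-- the exterior generator `y_{a+1}` (0-indexed `a`). -/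
def yV (F : Type) [Field F] (n a : ℕ) : LV F n :=
  if h : a < n then ExteriorAlgebra.ι F (Pi.single (⟨a, h⟩ : Fin n) (1 : F)) else 0

/-- the product `y_{s_1} ⋯ y_{s_j}` over `S = {s_1 < ⋯ < s_j}` in increasing order. -/
def yProd (F : Type) [Field F] (n : ℕ) (S : Finset ℕ) : LV F n :=
  ((S.sort (· ≤ ·)).map (yV F n)).prod

/-- determinant of the matrix `(x_t^{q^c})` with rows indexed by `c ∈ R` in increasing
order and columns by `t ∈ C` in increasing order; junk value `0` if sizes differ. -/
def subDet (F : Type) [Field F] (q n : ℕ) (R C : Finset ℕ) : SV F n :=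
  if h : C.card = R.card then
    Matrix.det (Matrix.of fun i j : Fin R.card =>
      xV F n (C.orderEmbOfFin h j) ^ q ^ (R.orderEmbOfFin rfl i : ℕ))
  else 0

/-- Mui's element `M_{m;b_1,…,b_j}` where `B = {b_1 < ⋯ < b_j}` (0-indexed `b`'s);
for `B = ∅` this is the Moore determinant `det (x_t^{q^c})`. -/
def MuiM (F : Type) [Field F] (q n m : ℕ) (B : Finset ℕ) : SL F n :=
  ∑ S ∈ (range m).powersetCard B.card,
    ((-1 : F) ^ (B.card * (B.card + 1) / 2 + (∑ s ∈ S, s) + B.card)) •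
      (subDet F q n (range m \ B) (range m \ S) ⊗ₜ[F] yProd F n S)

/-- `∏_{c : F^a} (c_1 x_1 + ⋯ + c_a x_a + x_{t+1})` (0-indexed `t`). -/
def linProd (F : Type) [Field F] [Fintype F] (n a t : ℕ) : SV F n :=
  ∏ c : Fin a → F, ((∑ k : Fin a, MvPolynomial.C (c k) * xV F n k) + xV F n t)

/-- Dickson's `L_m = V_1 V_2 ⋯ V_m`. -/
def Lm (F : Type) [Field F] [Fintype F] (n m : ℕ) : SV F n :=
  ∏ a ∈ range m, linProd F n a a

/-- The property characterizing the Dickson invariants `Q_{m,k}`: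
`Q_{m,k} · L_m = L_{m,k}` in `F[x_1,…,x_m]`. -/
def DicksonProp (F : Type) [Field F] [Fintype F] (q : ℕ)
    (Q : (m : ℕ) → ℕ → SV F m) : Prop :=
  ∀ m k : ℕ, k ≤ m →
    Q m k * Lm F m m = subDet F q m (range (m + 1) \ {k}) (range m)

/-- action of a matrix on `S(V)` by linear substitution: `x_j ↦ ∑_i g_{ij} x_i`. -/
def gAct (F : Type) [Field F] (n : ℕ) (g : Matrix (Fin n) (Fin n) F) :
    SV F n →ₐ[F] SV F n :=
  MvPolynomial.aeval fun j => ∑ i, MvPolynomial.C (g i j) * MvPolynomial.X i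

/-- action of a matrix on `Λ(V)` by linear substitution: `y_j ↦ ∑_i g_{ij} y_i`. -/
def eAct (F : Type) [Field F] (n : ℕ) (g : Matrix (Fin n) (Fin n) F) :
    LV F n →ₐ[F] LV F n :=
  ExteriorAlgebra.map g.mulVecLin

/-- diagonal action of a matrix on `S(V) ⊗ Λ(V)`. -/
def tAct (F : Type) [Field F] (n : ℕ) (g : Matrix (Fin n) (Fin n) F) :
    SL F n →ₐ[F] SL F n :=
  Algebra.TensorProduct.map (gAct F n g) (eAct F n g)

/-- the invariants of a set of matrices on `S(V) ⊗ Λ(V)`, as an `F`-subspace. -/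
def invSL (F : Type) [Field F] (n : ℕ) (P : Set (Matrix (Fin n) (Fin n) F)) :
    Submodule F (SL F n) where
  carrier := {f | ∀ g ∈ P, tAct F n g f = f}
  add_mem' := fun ha hb g hg => by rw [map_add, ha g hg, hb g hg]
  zero_mem' := fun g hg => map_zero _
  smul_mem' := fun c f hf g hg => by rw [map_smul, hf g hg]

/-- the invariants of `S(V) ⊗ Λ(V) ⊗ Det^k`, i.e. elements with
`det(g)^k (g·f) = f` for all `g ∈ P`. -/
def invSLtw (F : Type) [Field F] (n k : ℕ) (P : Set (Matrix (Fin n) (Fin n) F)) :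
    Submodule F (SL F n) where
  carrier := {f | ∀ g ∈ P, g.det ^ k • tAct F n g f = f}
  add_mem' := fun ha hb g hg => by rw [map_add, smul_add, ha g hg, hb g hg]
  zero_mem' := fun g hg => by rw [map_zero, smul_zero]
  smul_mem' := fun c f hf g hg => by rw [map_smul, smul_comm, hf g hg]

/-- the invariants of a set of matrices on `S(V)`, as an `F`-subalgebra. -/
def invS (F : Type) [Field F] (n : ℕ) (P : Set (Matrix (Fin n) (Fin n) F)) :
    Subalgebra F (SV F n) where
  carrier := {f | ∀ g ∈ P, gAct F n g f = f}
  mul_mem' := fun ha hb g hg => by rw [map_mul, ha g hg, hb g hg]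
  one_mem' := fun g hg => map_one _
  add_mem' := fun ha hb g hg => by rw [map_add, ha g hg, hb g hg]
  zero_mem' := fun g hg => map_zero _
  algebraMap_mem' := fun c g hg => (gAct F n g).commutes c

/-- `v_{i,j+1}` (0-indexed `j`) for the composition `I`. -/
def vij (F : Type) [Field F] [Fintype F] (n : ℕ) (I : Composition n)
    (i : Fin I.length) (j : ℕ) : SV F n :=
  linProd F n (I.sizeUpTo i) (I.sizeUpTo i + j)

/-- `θ_i = L_{n_i}(v_{i,1},…,v_{i,n_i})`. -/
def theta (F : Type) [Field F] [Fintype F] (n : ℕ) (I : Composition n)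
    (i : Fin I.length) : SV F n :=
  MvPolynomial.aeval (fun t : Fin (I.blocksFun i) => vij F n I i t)
    (Lm F (I.blocksFun i) (I.blocksFun i))

/-- `q_{i,k} = Q_{n_i,k}(v_{i,1},…,v_{i,n_i})`, given the Dickson polynomials `Q`. -/
def qInv (F : Type) [Field F] [Fintype F] (n : ℕ) (Q : (m : ℕ) → ℕ → SV F m)
    (I : Composition n) (i : Fin I.length) (k : ℕ) : SV F n :=
  MvPolynomial.aeval (fun t : Fin (I.blocksFun i) => vij F n I i t)
    (Q (I.blocksFun i) k)

/-- the index of the block (0-indexed) of the composition `I` containing `a`. -/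
def blkIdx (n : ℕ) (I : Composition n) (a : ℕ) : ℕ :=
  ((range I.length).filter fun i => I.sizeUpTo (i + 1) ≤ a).card

/-- the parabolic subgroup `P_I`: invertible block upper-triangular matrices. -/
def PIset (F : Type) [Field F] (n : ℕ) (I : Composition n) :
    Set (Matrix (Fin n) (Fin n) F) :=
  {g | IsUnit g.det ∧ ∀ a b : Fin n, blkIdx n I b < blkIdx n I a → g a b = 0}

/-- the subgroup `K_I ≤ P_I`: block upper-triangular with all diagonal blocks
of determinant `1`. -/
def KIset (F : Type) [Field F] (n : ℕ) (I : Composition n) :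
    Set (Matrix (Fin n) (Fin n) F) :=
  {g | IsUnit g.det ∧ (∀ a b : Fin n, blkIdx n I b < blkIdx n I a → g a b = 0) ∧
    ∀ i : Fin I.length,
      Matrix.det (Matrix.of fun a b : Fin (I.blocksFun i) =>
        g (I.embedding i a) (I.embedding i b)) = 1}

/-- the unipotent subgroup `U_n` of uni-uppertriangular matrices. -/
def Uset (F : Type) [Field F] (n : ℕ) : Set (Matrix (Fin n) (Fin n) F) :=
  {g | (∀ a b : Fin n, b < a → g a b = 0) ∧ ∀ a : Fin n, g a a = 1}

/-- `SL_n(q)`. -/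
def SLset (F : Type) [Field F] (n : ℕ) : Set (Matrix (Fin n) (Fin n) F) :=
  {g | g.det = 1}

/-- `GL_n(q)`. -/
def GLset (F : Type) [Field F] (n : ℕ) : Set (Matrix (Fin n) (Fin n) F) :=
  {g | IsUnit g.det}

/-- the bigraded piece `S^i(V) ⊗ Λ^j(V)` of `S(V) ⊗ Λ(V)`. -/
def piece (F : Type) [Field F] (n i j : ℕ) : Submodule F (SL F n) :=
  LinearMap.range (TensorProduct.map
    (MvPolynomial.homogeneousSubmodule (Fin n) F i).subtype
    (LinearMap.range (ExteriorAlgebra.ι F (M := Fin n → F)) ^ j).subtype)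

/-- the Hilbert series in `ℤ[s][[t]]` of a bigraded subspace `W` of `S(V) ⊗ Λ(V)`:
the coefficient of `t^i` is `∑_{j=0}^n dim (W ∩ (S^i ⊗ Λ^j)) s^j`. -/
def Hser (F : Type) [Field F] (n : ℕ) (W : Submodule F (SL F n)) :
    PowerSeries (Polynomial ℤ) :=
  PowerSeries.mk fun i => ∑ j ∈ range (n + 1),
    Polynomial.C (Module.finrank F ↥(W ⊓ piece F n i j) : ℤ) * Polynomial.X ^ j

/-- the Hilbert series in `ℤ[[t]]` of a graded subalgebra of `S(V)`. -/
def HserS (F : Type) [Field F] (n : ℕ) (W : Subalgebra F (SV F n)) :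
    PowerSeries ℤ :=
  PowerSeries.mk fun d =>
    (Module.finrank F ↥(Subalgebra.toSubmodule W ⊓ MvPolynomial.homogeneousSubmodule (Fin n) F d) : ℤ)

/-- the index set for Mui-type basis elements attached to the composition `I`:
pairs `(i, B)` with `B = {b_1 < ⋯ < b_j} ⊆ {0,…,m_{i+1}−1}` nonempty and
`max B ≥ m_i` (0-indexed `i`). -/
def Adm (n : ℕ) (I : Composition n) : Finset (Fin I.length × Finset ℕ) :=
  (Finset.univ ×ˢ (range n).powerset).filter fun x =>
    x.2 ⊆ range (I.sizeUpTo ((x.1 : ℕ) + 1)) ∧ x.2.Nonempty ∧ ∃ b ∈ x.2, I.sizeUpTo (x.1 : ℕ) ≤ b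

/-! ### Exterior algebras with a monomial basis -/

/-- An `S`-algebra `N` together with anticommuting elements `y 0, …, y (n - 1)` of square zero whose
increasing products form an `S`-basis, with coefficient functionals `cf`. -/
structure ExtBasis (S N : Type*) [CommRing S] [Ring N] [Algebra S N] (n : ℕ) where
  /-- the generators -/
  y : ℕ → N
  /-- the coefficient functionals -/
  cf : Finset ℕ → N →ₗ[S] S
  sq : ∀ t, y t * y t = 0
  swap : ∀ s t, y s * y t = -(y t * y s)
  zero_of_le : ∀ t, n ≤ t → y t = 0
  cf_mon : ∀ B B' : Finset ℕ, B ⊆ range n → B' ⊆ range n →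
    cf B (((B'.sort (· ≤ ·)).map y).prod) = if B' = B then 1 else 0
  sum_mon : ∀ f, ∑ B ∈ (range n).powerset, cf B f • ((B.sort (· ≤ ·)).map y).prod = f

namespace ExtBasis

variable {S N : Type*} [CommRing S] [Ring N] [Algebra S N] {n : ℕ} (E : ExtBasis S N n)

/-- The product of the generators along a list of indices. -/
def word (l : List ℕ) : N := (l.map E.y).prod

/-- The increasing product of the generators over a finite set of indices. -/
def e (B : Finset ℕ) : N := E.word (B.sort (· ≤ ·))

@[simp] lemma word_nil : E.word [] = 1 := rfl

lemma word_cons (a : ℕ) (l : List ℕ) : E.word (a :: l) = E.y a * E.word l := by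
  simp [word]

lemma word_append (l l' : List ℕ) : E.word (l ++ l') = E.word l * E.word l' := by
  simp [word]

lemma word_perm {l l' : List ℕ} (h : l.Perm l') :
    E.word l = E.word l' ∨ E.word l = -E.word l' := by
  induction h with
  | nil => simp
  | cons x _ ih =>
    rcases ih with ih | ih <;> simp [word_cons, ih]
  | swap x y l =>
    right
    rw [word_cons, word_cons, word_cons, word_cons, ← mul_assoc, ← mul_assoc, E.swap, neg_mul]
  | trans _ _ h1 h2 =>
    rcases h1 with h1 | h1 <;> rcases h2 with h2 | h2 <;> simp [h1, h2]

lemma word_eq_zero_of_not_nodup {l : List ℕ} (h : ¬ l.Nodup) : E.word l = 0 := by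
  obtain ⟨x, hx⟩ := List.exists_duplicate_iff_not_nodup.2 h
  obtain ⟨l', hl'⟩ := (List.duplicate_iff_sublist.1 hx).exists_perm_append
  have h0 : E.word ([x, x] ++ l') = 0 := by
    rw [word_append, word_cons, word_cons, word_nil, mul_one, E.sq, zero_mul]
  rcases E.word_perm hl' with h | h <;> rw [h, h0]
  rw [neg_zero]

@[simp] lemma e_empty : E.e ∅ = 1 := by simp [e]

lemma word_of_nodup {l : List ℕ} (h : l.Nodup) :
    E.word l = E.e l.toFinset ∨ E.word l = -E.e l.toFinset := by
  apply word_perm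
  rw [List.perm_ext_iff_of_nodup h (Finset.sort_nodup _ _)]
  simp

lemma y_mul_e_of_mem {t : ℕ} {B : Finset ℕ} (h : t ∈ B) : E.y t * E.e B = 0 := by
  rw [e, ← word_cons]
  exact E.word_eq_zero_of_not_nodup (by simp [h])

lemma y_mul_e_of_notMem {t : ℕ} {B : Finset ℕ} (h : t ∉ B) :
    E.y t * E.e B = E.e (insert t B) ∨ E.y t * E.e B = -E.e (insert t B) := by
  rw [e, ← word_cons]
  have := E.word_of_nodup (l := t :: B.sort (· ≤ ·)) (by simp [h])
  simpa using this

lemma cf_e {B B' : Finset ℕ} (h : B ⊆ range n) (h' : B' ⊆ range n) :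
    E.cf B (E.e B') = if B' = B then 1 else 0 := E.cf_mon B B' h h'

lemma sum_cf (f : N) : ∑ B ∈ (range n).powerset, E.cf B f • E.e B = f := E.sum_mon f

lemma cf_sum {c : Finset ℕ → S} {B : Finset ℕ} (hB : B ⊆ range n) :
    E.cf B (∑ B' ∈ (range n).powerset, c B' • E.e B') = c B := by
  rw [map_sum, Finset.sum_eq_single B]
  · rw [map_smul, E.cf_e hB hB, if_pos rfl, smul_eq_mul, mul_one]
  · intro B' hB' hne
    rw [map_smul, E.cf_e hB (mem_powerset.1 hB'), if_neg hne, smul_zero]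
  · intro h
    exact absurd (mem_powerset.2 hB) h

lemma ext_cf {f g : N} (h : ∀ B ⊆ range n, E.cf B f = E.cf B g) : f = g := by
  rw [← E.sum_cf f, ← E.sum_cf g]
  exact Finset.sum_congr rfl fun B hB => by rw [h B (mem_powerset.1 hB)]

lemma sq_sum (a : ℕ → S) (s : Finset ℕ) :
    (∑ c ∈ s, a c • E.y c) * (∑ c ∈ s, a c • E.y c) = 0 := by
  have hy : ∀ (d : ℕ) (s : Finset ℕ),
      E.y d * (∑ c ∈ s, a c • E.y c) = -((∑ c ∈ s, a c • E.y c) * E.y d) := by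
    intro d s
    rw [Finset.mul_sum, Finset.sum_mul, ← Finset.sum_neg_distrib]
    refine Finset.sum_congr rfl fun c _ => ?_
    rw [mul_smul_comm, smul_mul_assoc, E.swap, smul_neg]
  induction s using Finset.induction_on with
  | empty => simp
  | insert d s hd ih =>
    rw [Finset.sum_insert hd, add_mul, mul_add, mul_add, ih, smul_mul_smul_comm, E.sq, smul_zero,
      smul_mul_assoc, hy, mul_smul_comm]
    simp

lemma finite (E : ExtBasis S N n) : Module.Finite S N := by
  classical
  refine ⟨⟨(range n).powerset.image E.e, ?_⟩⟩
  rw [eq_top_iff]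
  intro f _
  rw [← E.sum_cf f]
  refine Submodule.sum_mem _ fun B hB => Submodule.smul_mem _ _ (Submodule.subset_span ?_)
  exact Finset.mem_coe.2 (Finset.mem_image_of_mem _ hB)

/-! ### The weight filtration -/

/-- The span of the words in the first `m` generators with index sum at least `k`. -/
def fil (m k : ℕ) : Submodule S N :=
  Submodule.span S (E.word '' {l | (∀ c ∈ l, c < m) ∧ k ≤ l.sum})

lemma word_mem_fil {m k : ℕ} {l : List ℕ} (h : ∀ c ∈ l, c < m) (hk : k ≤ l.sum) :
    E.word l ∈ E.fil m k := Submodule.subset_span ⟨l, ⟨h, hk⟩, rfl⟩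

lemma fil_mono {m m' k k' : ℕ} (hm : m ≤ m') (hk : k' ≤ k) : E.fil m k ≤ E.fil m' k' := by
  refine Submodule.span_mono (Set.image_mono ?_)
  rintro l ⟨h1, h2⟩
  exact ⟨fun c hc => (h1 c hc).trans_le hm, hk.trans h2⟩

lemma mul_mem_fil {m k k' : ℕ} {f g : N} (hf : f ∈ E.fil m k) (hg : g ∈ E.fil m k') :
    f * g ∈ E.fil m (k + k') := by
  have : E.fil m k * E.fil m k' ≤ E.fil m (k + k') := by
    rw [fil, fil, Submodule.span_mul_span, Submodule.span_le]
    rintro _ ⟨_, ⟨l, ⟨h1, h2⟩, rfl⟩, _, ⟨l', ⟨h1', h2'⟩, rfl⟩, rfl⟩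
    rw [SetLike.mem_coe]
    simp only
    rw [← word_append]
    refine E.word_mem_fil (fun c hc => ?_) (by rw [List.sum_append]; omega)
    rcases List.mem_append.1 hc with hc | hc
    exacts [h1 c hc, h1' c hc]
  exact this (Submodule.mul_mem_mul hf hg)

lemma sort_sum (B : Finset ℕ) : (B.sort (· ≤ ·)).sum = ∑ b ∈ B, b := by
  rw [Finset.sum_eq_multiset_sum, Multiset.map_id', ← Multiset.sum_coe, Finset.sort_eq]

lemma e_mem_fil {m k : ℕ} {B : Finset ℕ} (h : B ⊆ range m) (hk : k ≤ ∑ b ∈ B, b) :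
    E.e B ∈ E.fil m k :=
  E.word_mem_fil (fun c hc => mem_range.1 (h ((Finset.mem_sort _).1 hc)))
    (by rw [sort_sum]; exact hk)

lemma fil_le_span (m k : ℕ) :
    E.fil m k ≤ Submodule.span S (E.e '' {B | B ⊆ range m ∧ k ≤ ∑ b ∈ B, b}) := by
  rw [fil, Submodule.span_le]
  rintro _ ⟨l, ⟨h1, h2⟩, rfl⟩
  by_cases hl : l.Nodup
  · have hmem : E.e l.toFinset ∈
        Submodule.span S (E.e '' {B | B ⊆ range m ∧ k ≤ ∑ b ∈ B, b}) := by
      refine Submodule.subset_span ⟨l.toFinset, ⟨fun c hc => ?_, ?_⟩, rfl⟩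
      · exact mem_range.2 (h1 c (List.mem_toFinset.1 hc))
      · rwa [List.sum_toFinset (fun b => b) hl, List.map_id']
    rcases E.word_of_nodup hl with h | h <;> rw [SetLike.mem_coe, h]
    · exact hmem
    · exact Submodule.neg_mem _ hmem
  · rw [SetLike.mem_coe, E.word_eq_zero_of_not_nodup hl]
    exact Submodule.zero_mem _

lemma fil_eq_bot {m k : ℕ} (hk : ∑ b ∈ range m, b < k) : E.fil m k = ⊥ := by
  rw [eq_bot_iff]
  refine (E.fil_le_span m k).trans ?_
  rw [Submodule.span_le]
  rintro _ ⟨B, ⟨h1, h2⟩, rfl⟩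
  have := Finset.sum_le_sum_of_subset (f := fun b : ℕ => b) h1
  omega

lemma fil_top : E.fil n 0 = ⊤ := by
  rw [eq_top_iff]
  intro f _
  rw [← E.sum_cf f]
  exact Submodule.sum_mem _ fun B hB => Submodule.smul_mem _ _
    (E.e_mem_fil (mem_powerset.1 hB) (Nat.zero_le _))

lemma cf_eq_zero_of_mem_fil {m k : ℕ} (hm : m ≤ n) {B : Finset ℕ} (hB : B ⊆ range n)
    (hB' : ¬ B ⊆ range m) {f : N} (hf : f ∈ E.fil m k) : E.cf B f = 0 := by
  have : Submodule.span S (E.e '' {B | B ⊆ range m ∧ k ≤ ∑ b ∈ B, b}) ≤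
      LinearMap.ker (E.cf B) := by
    rw [Submodule.span_le]
    rintro _ ⟨C, ⟨h1, _⟩, rfl⟩
    rw [SetLike.mem_coe, LinearMap.mem_ker,
      E.cf_e hB (h1.trans (Finset.range_subset_range.2 hm)), if_neg]
    rintro rfl
    exact hB' h1
  exact this (E.fil_le_span m k hf)

/-- An algebra endomorphism which is unitriangular on the generators in `l` is unipotent with
respect to the weight filtration. -/
lemma map_word_sub_mem_fil {m : ℕ} (φ : N →ₐ[S] N) (l : List ℕ) (hl : ∀ c ∈ l, c < m)
    (h : ∀ c ∈ l, φ (E.y c) - E.y c ∈ E.fil m (c + 1)) :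
    φ (E.word l) - E.word l ∈ E.fil m (l.sum + 1) := by
  induction l with
  | nil => simp
  | cons a l ih =>
    have ih := ih (fun c hc => hl c (List.mem_cons_of_mem _ hc))
      (fun c hc => h c (List.mem_cons_of_mem _ hc))
    have ha := h a List.mem_cons_self
    have hya : E.y a ∈ E.fil m a := by
      have := E.word_mem_fil (m := m) (k := a) (l := [a])
        (fun c hc => hl c (by simp_all)) (by simp)
      simpa [word_cons] using this
    have hw : E.word l ∈ E.fil m l.sum :=
      E.word_mem_fil (fun c hc => hl c (List.mem_cons_of_mem _ hc)) le_rfl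
    have hφ : φ (E.word l) ∈ E.fil m l.sum := by
      have := Submodule.add_mem _ (E.fil_mono le_rfl (Nat.le_succ _) ih) hw
      simpa using this
    have : φ (E.word (a :: l)) - E.word (a :: l) =
        (φ (E.y a) - E.y a) * φ (E.word l) + E.y a * (φ (E.word l) - E.word l) := by
      rw [word_cons, map_mul, sub_mul, mul_sub]; abel
    rw [this, List.sum_cons]
    refine Submodule.add_mem _ ?_ ?_
    · exact E.fil_mono le_rfl (by omega) (E.mul_mem_fil ha hφ)
    · exact E.fil_mono le_rfl (by omega) (E.mul_mem_fil hya ih)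

lemma y_mem_fil {m c : ℕ} (hc : c < m) : E.y c ∈ E.fil m c := by
  have := E.word_mem_fil (m := m) (k := c) (l := [c]) (fun d hd => by simp_all) (by simp)
  simpa [word_cons] using this

end ExtBasis

namespace ExtBasis

variable {S N : Type*} [CommRing S] [Ring N] [Algebra S N] {n : ℕ} (E : ExtBasis S N n)

/-! ### Transvections -/

lemma map_e_of_fixed (φ : N →ₐ[S] N) {B : Finset ℕ} (h : ∀ c ∈ B, φ (E.y c) = E.y c) :
    φ (E.e B) = E.e B := by
  have : ∀ l : List ℕ, (∀ c ∈ l, φ (E.y c) = E.y c) → φ (E.word l) = E.word l := by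
    intro l
    induction l with
    | nil => simp
    | cons a l ih =>
      intro hl
      rw [word_cons, map_mul, hl a List.mem_cons_self,
        ih fun c hc => hl c (List.mem_cons_of_mem _ hc)]
  exact this _ fun c hc => h c ((Finset.mem_sort _).1 hc)

lemma e_eq_y_mul {t : ℕ} {B : Finset ℕ} (ht : t ∈ B) :
    E.e B = E.y t * E.e (B.erase t) ∨ E.e B = -(E.y t * E.e (B.erase t)) := by
  have := E.y_mul_e_of_notMem (Finset.notMem_erase t B)
  rw [Finset.insert_erase ht] at this
  rcases this with h | h
  · exact Or.inl h.symm
  · right; rw [h, neg_neg]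

lemma dvd_cf_of_transvection (φ : N →ₐ[S] N) {s t : ℕ} (hst : s ≠ t) (hs : s < n)
    (hφt : φ (E.y t) = E.y t + E.y s) (hφ : ∀ c, c ≠ t → φ (E.y c) = E.y c)
    {x : S} {f u : N} (hf : φ f - f = x • u) {B : Finset ℕ} (hB : B ⊆ range n)
    (htB : t ∈ B) (hsB : s ∉ B) : x ∣ E.cf B f := by
  have hB1 : insert s (B.erase t) ⊆ range n := by
    intro c hc
    rcases Finset.mem_insert.1 hc with rfl | hc
    · exact mem_range.2 hs
    · exact hB (Finset.mem_of_mem_erase hc)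
  have hdiff : ∀ C : Finset ℕ, t ∈ C →
      φ (E.e C) - E.e C = E.y s * E.e (C.erase t) ∨
      φ (E.e C) - E.e C = -(E.y s * E.e (C.erase t)) := by
    intro C hC
    have hfix : φ (E.e (C.erase t)) = E.e (C.erase t) :=
      E.map_e_of_fixed φ fun c hc => hφ c (Finset.ne_of_mem_erase hc)
    rcases E.e_eq_y_mul hC with h | h
    · left; rw [h, map_mul, hfix, hφt, add_mul]; abel
    · right; rw [h, map_neg, map_mul, hfix, hφt, add_mul]; abel
  have hother : ∀ C ∈ (range n).powerset, C ≠ B →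
      E.cf (insert s (B.erase t)) (φ (E.e C) - E.e C) = 0 := by
    intro C hC hne
    by_cases htC : t ∈ C
    · have key : E.cf (insert s (B.erase t)) (E.y s * E.e (C.erase t)) = 0 := by
        by_cases hsC : s ∈ C
        · rw [E.y_mul_e_of_mem (Finset.mem_erase.2 ⟨hst, hsC⟩), map_zero]
        · have hsC' : s ∉ C.erase t := fun h => hsC (Finset.mem_of_mem_erase h)
          have hC1 : insert s (C.erase t) ⊆ range n := by
            intro c hc
            rcases Finset.mem_insert.1 hc with rfl | hc
            · exact mem_range.2 hs
            · exact mem_powerset.1 hC (Finset.mem_of_mem_erase hc)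
          have hne' : insert s (C.erase t) ≠ insert s (B.erase t) := by
            intro h
            apply hne
            have h2 : C.erase t = B.erase t := by
              rw [← Finset.erase_insert hsC', h,
                Finset.erase_insert fun h => hsB (Finset.mem_of_mem_erase h)]
            rw [← Finset.insert_erase htC, h2, Finset.insert_erase htB]
          rcases E.y_mul_e_of_notMem hsC' with h | h <;> rw [h]
          · rw [E.cf_e hB1 hC1, if_neg hne']
          · rw [map_neg, E.cf_e hB1 hC1, if_neg hne', neg_zero]
      rcases hdiff C htC with h | h <;> rw [h]
      · exact key
      · rw [map_neg, key, neg_zero]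
    · rw [E.map_e_of_fixed φ, sub_self, map_zero]
      rintro c hc
      exact hφ c (by rintro rfl; exact htC hc)
  have hBB : E.cf (insert s (B.erase t)) (φ (E.e B) - E.e B) = 1 ∨
      E.cf (insert s (B.erase t)) (φ (E.e B) - E.e B) = -1 := by
    have hs' : s ∉ B.erase t := fun h => hsB (Finset.mem_of_mem_erase h)
    rcases hdiff B htB with h | h <;> rcases E.y_mul_e_of_notMem hs' with h' | h' <;>
      rw [h, h'] <;> simp [E.cf_e hB1 hB1]
  have hsum : E.cf (insert s (B.erase t)) (φ f - f) =
      E.cf B f * E.cf (insert s (B.erase t)) (φ (E.e B) - E.e B) := by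
    conv_lhs => rw [← E.sum_cf f, map_sum, ← Finset.sum_sub_distrib, map_sum]
    rw [Finset.sum_eq_single B]
    · rw [map_smul, ← smul_sub, map_smul, smul_eq_mul]
    · intro C hC hne
      rw [map_smul, ← smul_sub, map_smul, hother C hC hne, smul_zero]
    · intro h; exact absurd (mem_powerset.2 hB) h
  rw [hf, map_smul, smul_eq_mul] at hsum
  rcases hBB with h | h <;> rw [h] at hsum
  · exact ⟨_, by rw [hsum, mul_one]⟩
  · rw [mul_neg, mul_one] at hsum
    exact (dvd_neg.1 ⟨_, hsum.symm⟩)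

/-! ### The change of basis attached to a set of levels -/

/-- The smallest level `m ∈ M` with `B ⊆ {0, …, m - 1}`. -/
def lev (M : Set ℕ) (B : Finset ℕ) : ℕ := sInf {m | m ∈ M ∧ B ⊆ range m}

lemma lev_spec {M : Set ℕ} {B : Finset ℕ} {m : ℕ} (hm : m ∈ M) (hB : B ⊆ range m) :
    lev M B ∈ M ∧ B ⊆ range (lev M B) := Nat.sInf_mem (s := {m | m ∈ M ∧ B ⊆ range m}) ⟨m, hm, hB⟩

lemma lev_le {M : Set ℕ} {B : Finset ℕ} {m : ℕ} (hm : m ∈ M) (hB : B ⊆ range m) :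
    lev M B ≤ m := Nat.sInf_le (s := {m | m ∈ M ∧ B ⊆ range m}) ⟨hm, hB⟩

/-- A family of algebra endomorphisms `T m`, with `T n = id`, such that for `j ≤ m` the restriction
of `T j` to the words in the first `j` generators factors as `T m` composed with a unitriangular
endomorphism of the words in the first `m` generators. -/
structure IsTower (T : ℕ → N →ₐ[S] N) : Prop where
  last : T n = AlgHom.id S N
  trans : ∀ j m, j ≤ m → m ≤ n → ∃ φ : N →ₐ[S] N, ∀ c < j,
    T j (E.y c) = T m (φ (E.y c)) ∧ φ (E.y c) - E.y c ∈ E.fil m (c + 1)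

/-- The endomorphism mapping `e B` to `T m (e B)`, where `m` is the smallest level with
`B ⊆ {0, …, m - 1}`. -/
def theta (M : Set ℕ) (T : ℕ → N →ₐ[S] N) : N →ₗ[S] N :=
  ∑ B ∈ (range n).powerset, (E.cf B).smulRight (T (lev M B) (E.e B))

lemma theta_apply (M : Set ℕ) (T : ℕ → N →ₐ[S] N) (f : N) :
    E.theta M T f = ∑ B ∈ (range n).powerset, E.cf B f • T (lev M B) (E.e B) := by
  simp [theta, LinearMap.sum_apply]

lemma theta_e (M : Set ℕ) (T : ℕ → N →ₐ[S] N) {B : Finset ℕ} (hB : B ⊆ range n) :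
    E.theta M T (E.e B) = T (lev M B) (E.e B) := by
  rw [theta_apply, Finset.sum_eq_single B]
  · rw [E.cf_e hB hB, if_pos rfl, one_smul]
  · intro C hC hne
    rw [E.cf_e (mem_powerset.1 hC) hB, if_neg hne.symm, zero_smul]
  · intro h; exact absurd (mem_powerset.2 hB) h

variable {E} {T : ℕ → N →ₐ[S] N} {M : Set ℕ}

lemma IsTower.map_word_eq (hT : E.IsTower T) {j m : ℕ} (hjm : j ≤ m) (hm : m ≤ n) :
    ∀ l : List ℕ, (∀ c ∈ l, c < j) →
      ∃ w ∈ E.fil m (l.sum + 1), T j (E.word l) = T m (E.word l + w) := by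
  intro l hl
  obtain ⟨φ, hφ⟩ := hT.trans j m hjm hm
  refine ⟨φ (E.word l) - E.word l, E.map_word_sub_mem_fil φ l (fun c hc => (hl c hc).trans_le hjm)
    fun c hc => (hφ c (hl c hc)).2, ?_⟩
  rw [add_sub_cancel]
  induction l with
  | nil => simp
  | cons a l ih =>
    rw [word_cons, map_mul, map_mul, map_mul, (hφ a (hl a List.mem_cons_self)).1,
      ih fun c hc => hl c (List.mem_cons_of_mem _ hc)]

lemma IsTower.map_mem_theta (hT : E.IsTower T) {m : ℕ} (hm : m ∈ M) (hmn : m ≤ n) (k : ℕ) :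
    ∀ f ∈ E.fil m k, ∃ g ∈ E.fil m 0, E.theta M T g = T m f := by
  obtain ⟨d, hd⟩ : ∃ d, ∑ b ∈ range m, b + 1 - k ≤ d := ⟨_, le_rfl⟩
  induction d generalizing k with
  | zero =>
    intro f hf
    rw [E.fil_eq_bot (by omega), Submodule.mem_bot] at hf
    exact ⟨0, Submodule.zero_mem _, by rw [hf, map_zero, map_zero]⟩
  | succ d ih =>
    have : E.fil m k ≤ ((E.fil m 0).map (E.theta M T)).comap (T m).toLinearMap := by
      refine (E.fil_le_span m k).trans ?_
      rw [Submodule.span_le]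
      rintro _ ⟨B, ⟨h1, h2⟩, rfl⟩
      rw [SetLike.mem_coe, Submodule.mem_comap, AlgHom.toLinearMap_apply]
      have hBn : B ⊆ range n := h1.trans (Finset.range_subset_range.2 hmn)
      have hspec := lev_spec hm h1
      obtain ⟨w, hw, hw'⟩ := hT.map_word_eq (lev_le hm h1) hmn (B.sort (· ≤ ·))
        (fun c hc => mem_range.1 (hspec.2 ((Finset.mem_sort _).1 hc)))
      rw [sort_sum] at hw
      obtain ⟨g, hg, hg'⟩ := ih (∑ b ∈ B, b + 1) (by omega) w hw
      refine ⟨E.e B - g, Submodule.sub_mem _ (E.e_mem_fil h1 (Nat.zero_le _)) hg, ?_⟩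
      rw [map_sub, E.theta_e M T hBn, hg', e, hw', map_add, add_sub_cancel_right]
    intro f hf
    obtain ⟨g, hg, hg'⟩ := this hf
    exact ⟨g, hg, hg'⟩

lemma IsTower.theta_bijective (hT : E.IsTower T) (hM : n ∈ M) :
    Function.Bijective (E.theta M T) := by
  have hs : Function.Surjective (E.theta M T) := by
    intro f
    obtain ⟨g, _, hg⟩ := hT.map_mem_theta hM le_rfl 0 f (by rw [E.fil_top]; trivial)
    exact ⟨g, by rw [hg, hT.last]; rfl⟩
  have := E.finite
  exact ⟨OrzechProperty.injective_of_surjective_endomorphism _ hs, hs⟩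

/-- The divisibility criterion for the coefficients of `Φ f` in the basis `T (lev B) (e B)`. -/
lemma IsTower.dvd_cf (hT : E.IsTower T) (hM : n ∈ M) {m s : ℕ} (hm : m ∈ M) (hmn : m ≤ n)
    (Φ : N →ₐ[S] N) {x : S} {u : N} (hs : Φ (E.y s) = x • u)
    (hΦ : ∀ t < m, ∃ w ∈ E.fil m 0, Φ (E.y t) = T m w)
    {f h : N} (hh : E.theta M T h = Φ f)
    (hf : ∀ B ⊆ range n, ¬ B ⊆ range m → s ∉ B → x ∣ E.cf B f)
    {B : Finset ℕ} (hB : B ⊆ range n) (hBm : ¬ B ⊆ range m) : x ∣ E.cf B h := by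
  have hword : ∀ l : List ℕ, (∀ c ∈ l, c < m) → ∃ w ∈ E.fil m 0, Φ (E.word l) = T m w := by
    intro l
    induction l with
    | nil =>
      intro _
      exact ⟨E.word [], E.word_mem_fil (by simp) (by simp), by simp⟩
    | cons a l ih =>
      intro hl
      obtain ⟨w, hw, hw'⟩ := ih fun c hc => hl c (List.mem_cons_of_mem _ hc)
      obtain ⟨v, hv, hv'⟩ := hΦ a (hl a List.mem_cons_self)
      have := E.mul_mem_fil hv hw
      rw [add_zero] at this
      exact ⟨v * w, this, by rw [word_cons, map_mul, hw', hv', map_mul]⟩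
  have hterm : ∀ C ⊆ range n, ∃ g ∈ E.fil m 0, ∃ v, E.cf C f • Φ (E.e C) = x • v + E.theta M T g := by
    intro C hC
    by_cases hCm : C ⊆ range m
    · obtain ⟨w, hw, hw'⟩ := hword (C.sort (· ≤ ·))
        fun c hc => mem_range.1 (hCm ((Finset.mem_sort _).1 hc))
      obtain ⟨g, hg, hg'⟩ := hT.map_mem_theta hm hmn 0 w hw
      refine ⟨E.cf C f • g, Submodule.smul_mem _ _ hg, 0, ?_⟩
      rw [smul_zero, zero_add, map_smul, hg', e, hw']
    · refine ⟨0, Submodule.zero_mem _, ?_⟩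
      by_cases hsC : s ∈ C
      · rcases E.e_eq_y_mul hsC with h | h
        · refine ⟨E.cf C f • (u * Φ (E.e (C.erase s))), ?_⟩
          rw [h, map_mul, hs, map_zero, add_zero, smul_mul_assoc, smul_comm]
        · refine ⟨-(E.cf C f • (u * Φ (E.e (C.erase s)))), ?_⟩
          rw [h, map_neg, map_mul, hs, map_zero, add_zero, smul_mul_assoc, smul_neg, smul_neg,
            smul_comm]
      · obtain ⟨a, ha⟩ := hf C hC hCm hsC
        refine ⟨a • Φ (E.e C), ?_⟩
        rw [ha, map_zero, add_zero, mul_smul]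
  choose! g hg v hv using hterm
  have hΦf : Φ f = x • (∑ C ∈ (range n).powerset, v C) +
      E.theta M T (∑ C ∈ (range n).powerset, g C) := by
    conv_lhs => rw [← E.sum_cf f, map_sum]
    rw [Finset.smul_sum, map_sum, ← Finset.sum_add_distrib]
    refine Finset.sum_congr rfl fun C hC => ?_
    rw [map_smul, hv C (mem_powerset.1 hC)]
  obtain ⟨a, ha⟩ := (hT.theta_bijective hM).2 (∑ C ∈ (range n).powerset, v C)
  have hfin : h = x • a + ∑ C ∈ (range n).powerset, g C := by
    apply (hT.theta_bijective hM).1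
    rw [hh, hΦf, map_add, map_smul, ha]
  rw [hfin, map_add, E.cf_eq_zero_of_mem_fil hmn hB hBm
    (Submodule.sum_mem _ fun C hC => hg C (mem_powerset.1 hC)), add_zero, map_smul, smul_eq_mul]
  exact dvd_mul_right _ _

end ExtBasis

/-! ### Minors -/

/-- The minor of `(u t c)` with rows `c ∈ R` and columns `t ∈ C` in increasing order; `0` if the
sizes differ. -/
def minor {S : Type*} [CommRing S] (u : ℕ → ℕ → S) (R C : Finset ℕ) : S :=
  if h : C.card = R.card then
    Matrix.det (Matrix.of fun i j : Fin R.card =>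
      u (C.orderEmbOfFin h j) (R.orderEmbOfFin rfl i : ℕ))
  else 0

lemma sort_map_eq_ofFn {ι α : Type*} [LinearOrder ι] (f : ι → α) (C : Finset ι) {k : ℕ}
    (h : C.card = k) :
    (C.sort (· ≤ ·)).map f = List.ofFn fun i => f (C.orderEmbOfFin h i) := by
  rw [← Finset.listMap_orderEmbOfFin_finRange C h, List.map_map, List.ofFn_eq_map]
  rfl

lemma minor_congr {S : Type*} [CommRing S] {u v : ℕ → ℕ → S} {R C : Finset ℕ}
    (h : ∀ t ∈ C, ∀ c ∈ R, u t c = v t c) : minor u R C = minor v R C := by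
  unfold minor
  split_ifs with hc
  · congr 1
    ext i j
    exact h _ (Finset.orderEmbOfFin_mem ..) _ (Finset.orderEmbOfFin_mem ..)
  · rfl

lemma minor_eq_zero_of_row {S : Type*} [CommRing S] {u : ℕ → ℕ → S} {R C : Finset ℕ} {c : ℕ}
    (hc : c ∈ R) (h : ∀ t ∈ C, u t c = 0) : minor u R C = 0 := by
  unfold minor
  split_ifs with hcard
  · obtain ⟨i, hi⟩ : c ∈ Set.range (R.orderEmbOfFin rfl) := by simpa using hc
    refine Matrix.det_eq_zero_of_row_eq_zero i fun j => ?_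
    rw [Matrix.of_apply, hi]
    exact h _ (Finset.orderEmbOfFin_mem ..)
  · rfl

lemma minor_eq_zero_of_rows_eq {S : Type*} [CommRing S] {u : ℕ → ℕ → S} {R C : Finset ℕ}
    {c d : ℕ} (hc : c ∈ R) (hd : d ∈ R) (hcd : c ≠ d) (h : ∀ t ∈ C, u t c = u t d) :
    minor u R C = 0 := by
  unfold minor
  split_ifs with hcard
  · obtain ⟨i, hi⟩ : c ∈ Set.range (R.orderEmbOfFin rfl) := by simpa using hc
    obtain ⟨j, hj⟩ : d ∈ Set.range (R.orderEmbOfFin rfl) := by simpa using hd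
    refine Matrix.det_zero_of_row_eq (i := i) (j := j) (fun hij => hcd (by rw [← hi, ← hj, hij])) ?_
    funext k
    rw [Matrix.of_apply, Matrix.of_apply, hi, hj]
    exact h _ (Finset.orderEmbOfFin_mem ..)
  · rfl

namespace ExtBasis

variable {S N : Type*} [CommRing S] [Ring N] [Algebra S N] {n : ℕ} (E : ExtBasis S N n)

/-- The linear combination of the generators with coefficients `u`. -/
def lin : (Fin n → S) →ₗ[S] N where
  toFun u := ∑ i, u i • E.y i
  map_add' u v := by simp [add_smul, Finset.sum_add_distrib]
  map_smul' a u := by simp [Finset.smul_sum, mul_smul]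

lemma lin_apply (u : ℕ → S) : E.lin (fun i => u i) = ∑ c ∈ range n, u c • E.y c :=
  (Finset.sum_range (fun c => u c • E.y c)).symm

lemma lin_single (i : Fin n) : E.lin (Pi.single i 1) = E.y i := by
  rw [lin, LinearMap.coe_mk, AddHom.coe_mk, Finset.sum_eq_single i]
  · simp
  · intro j _ hj
    simp [hj]
  · simp

lemma lin_sq (u : Fin n → S) : E.lin u * E.lin u = 0 := by
  have := E.sq_sum (fun c => if h : c < n then u ⟨c, h⟩ else 0) (range n)
  rw [← lin_apply] at this
  simpa using this

/-- The product of `k` linear combinations of generators, as an alternating map. -/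
def prodLin (k : ℕ) : (Fin n → S) [⋀^Fin k]→ₗ[S] N :=
  (ExteriorAlgebra.lift S ⟨E.lin, E.lin_sq⟩).toLinearMap.compAlternatingMap
    (ExteriorAlgebra.ιMulti S k)

lemma prodLin_apply {k : ℕ} (u : Fin k → Fin n → S) :
    E.prodLin k u = (List.ofFn fun i => E.lin (u i)).prod := by
  rw [prodLin, LinearMap.compAlternatingMap_apply, ExteriorAlgebra.ιMulti_apply,
    AlgHom.toLinearMap_apply, map_list_prod, List.map_ofFn]
  congr 2
  funext i
  simp

lemma cf_prodLin {k : ℕ} (u : Fin k → Fin n → S) {C : Finset ℕ} (hC : C ⊆ range n)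
    (h : C.card = k) :
    E.cf C (E.prodLin k u) = Matrix.det (Matrix.of fun i j : Fin k =>
      u i ⟨C.orderEmbOfFin h j, mem_range.1 (hC (Finset.orderEmbOfFin_mem ..))⟩) := by
  set κ : Fin k → Fin n := fun j => ⟨C.orderEmbOfFin h j, mem_range.1 (hC (Finset.orderEmbOfFin_mem ..))⟩
    with hκ
  suffices H : (E.cf C).compAlternatingMap (E.prodLin k) =
      Matrix.detRowAlternating.compLinearMap (LinearMap.funLeft S S κ) by
    exact congrArg (fun g => g u) H
  refine Module.Basis.ext_alternating (Pi.basisFun S (Fin n)) fun v hv => ?_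
  have hword : ∀ v : Fin k → Fin n, E.prodLin k (fun i => Pi.basisFun S (Fin n) (v i)) =
      E.word (List.ofFn fun i => (v i : ℕ)) := by
    intro v
    rw [prodLin_apply, word, List.map_ofFn]
    congr 2
    funext i
    rw [Pi.basisFun_apply, lin_single]
    rfl
  by_cases hvC : ∀ i, (v i : ℕ) ∈ C
  · obtain ⟨σ, hσ⟩ : ∃ σ : Equiv.Perm (Fin k), ∀ i, v i = κ (σ i) := by
      set f : Fin k → Fin k := fun i => (C.orderIsoOfFin h).symm ⟨v i, hvC i⟩ with hf
      have hfv : ∀ i, C.orderEmbOfFin h (f i) = v i := by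
        intro i
        rw [← Finset.coe_orderIsoOfFin_apply, hf, OrderIso.apply_symm_apply]
      have hinj : Function.Injective f := by
        intro i j hij
        apply hv
        apply Fin.ext
        rw [← hfv, ← hfv, hij]
      refine ⟨Equiv.ofBijective f (Finite.injective_iff_bijective.1 hinj), fun i => Fin.ext ?_⟩
      exact (hfv i).symm
    have hb : (fun i => Pi.basisFun S (Fin n) (v i)) =
        (fun i => Pi.basisFun S (Fin n) (κ i)) ∘ σ := by
      funext i
      rw [hσ, Function.comp_apply]
    rw [hb, AlternatingMap.map_perm, AlternatingMap.map_perm]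
    congr 1
    rw [LinearMap.compAlternatingMap_apply, hword]
    have : E.word (List.ofFn fun i => (κ i : ℕ)) = E.e C := by
      rw [e, word, word]
      congr 2
      have := sort_map_eq_ofFn id C h
      rw [List.map_id] at this
      rw [this]
      rfl
    rw [this, E.cf_e hC hC, if_pos rfl, AlternatingMap.compLinearMap_apply]
    symm
    refine (congrArg Matrix.det ?_).trans (Matrix.det_one (n := Fin k) (R := S))
    ext i j
    have hκi : Function.Injective κ := fun i j hij =>
      (C.orderEmbOfFin h).injective (Fin.mk.inj_iff.1 hij)
    simp [LinearMap.funLeft_apply, Pi.single_apply, Matrix.one_apply, hκi.eq_iff, eq_comm]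
  · push Not at hvC
    obtain ⟨i, hi⟩ := hvC
    rw [LinearMap.compAlternatingMap_apply, hword, AlternatingMap.compLinearMap_apply]
    have hnd : (List.ofFn fun i => (v i : ℕ)).Nodup :=
      List.nodup_ofFn.2 fun i j hij => hv (Fin.ext hij)
    have h0 : E.cf C (E.word (List.ofFn fun i => (v i : ℕ))) = 0 := by
      have hsub : (List.ofFn fun i => (v i : ℕ)).toFinset ⊆ range n := by
        intro c hc
        simp only [List.mem_toFinset, List.mem_ofFn] at hc
        obtain ⟨j, rfl⟩ := hc
        exact mem_range.2 (v j).2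
      have hne : (List.ofFn fun i => (v i : ℕ)).toFinset ≠ C := by
        intro hEq
        apply hi
        rw [← hEq, List.mem_toFinset, List.mem_ofFn]
        exact ⟨i, rfl⟩
      rcases E.word_of_nodup hnd with hw | hw
      · rw [hw, E.cf_e hC hsub, if_neg hne]
      · rw [hw, map_neg, E.cf_e hC hsub, if_neg hne, neg_zero]
    rw [h0]
    symm
    refine Matrix.det_eq_zero_of_row_eq_zero i fun j => ?_
    have : v i ≠ κ j := by
      intro hij
      apply hi
      rw [hij]
      exact Finset.orderEmbOfFin_mem ..
    simp [LinearMap.funLeft_apply, this.symm]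

/-- The product of linear combinations indexed by a finite set, in increasing order. -/
def sprod (u : ℕ → ℕ → S) (T : Finset ℕ) : N :=
  ((T.sort (· ≤ ·)).map fun t => ∑ c ∈ range n, u t c • E.y c).prod

lemma sprod_eq (u : ℕ → ℕ → S) (T : Finset ℕ) {k : ℕ} (h : T.card = k) :
    E.sprod u T = E.prodLin k fun i c => u (T.orderEmbOfFin h i) c := by
  rw [sprod, sort_map_eq_ofFn _ T h, prodLin_apply]
  congr 2
  funext i
  rw [lin_apply]

lemma cf_sprod_of_card (u : ℕ → ℕ → S) {T C : Finset ℕ} (hC : C ⊆ range n) (h : T.card = C.card) :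
    E.cf C (E.sprod u T) = minor u C T := by
  rw [E.sprod_eq u T h, E.cf_prodLin _ hC rfl, minor, dif_pos h, ← Matrix.det_transpose]
  rfl

lemma cf_sprod_of_card_ne (u : ℕ → ℕ → S) {T C : Finset ℕ} (hC : C ⊆ range n)
    (h : T.card ≠ C.card) : E.cf C (E.sprod u T) = 0 := by
  have key : ∀ k : ℕ, k ≠ C.card → (E.cf C).compAlternatingMap (E.prodLin k) = 0 := by
    intro k hk
    refine Module.Basis.ext_alternating (Pi.basisFun S (Fin n)) fun v hv => ?_
    have hword : E.prodLin k (fun i => Pi.basisFun S (Fin n) (v i)) =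
        E.word (List.ofFn fun i => (v i : ℕ)) := by
      rw [prodLin_apply, word, List.map_ofFn]
      congr 2
      funext i
      rw [Pi.basisFun_apply, lin_single]
      rfl
    have hnd : (List.ofFn fun i => (v i : ℕ)).Nodup :=
      List.nodup_ofFn.2 fun i j hij => hv (Fin.ext hij)
    have hsub : (List.ofFn fun i => (v i : ℕ)).toFinset ⊆ range n := by
      intro c hc
      simp only [List.mem_toFinset, List.mem_ofFn] at hc
      obtain ⟨j, rfl⟩ := hc
      exact mem_range.2 (v j).2
    have hne : (List.ofFn fun i => (v i : ℕ)).toFinset ≠ C := by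
      intro hEq
      apply hk
      rw [← hEq, List.toFinset_card_of_nodup hnd, List.length_ofFn]
    rw [LinearMap.compAlternatingMap_apply, hword, AlternatingMap.zero_apply]
    rcases E.word_of_nodup hnd with hw | hw
    · rw [hw, E.cf_e hC hsub, if_neg hne]
    · rw [hw, map_neg, E.cf_e hC hsub, if_neg hne, neg_zero]
  rw [E.sprod_eq u T rfl]
  exact DFunLike.congr_fun (key _ h) _

lemma cf_sprod (u : ℕ → ℕ → S) (T : Finset ℕ) {C : Finset ℕ} (hC : C ⊆ range n) :
    E.cf C (E.sprod u T) = minor u C T := by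
  by_cases h : T.card = C.card
  · exact E.cf_sprod_of_card u hC h
  · rw [E.cf_sprod_of_card_ne u hC h, minor, dif_neg h]

/-- Linear combinations supported on `X`. -/
lemma sprod_of_support (u : ℕ → ℕ → S) {T X : Finset ℕ} (hX : X ⊆ range n)
    (hu : ∀ t ∈ T, ∀ c, c ∉ X → u t c = 0) (hTX : X.card ≤ T.card) :
    E.sprod u T = minor u X T • E.e X := by
  refine E.ext_cf fun C hC => ?_
  rw [E.cf_sprod u T hC, map_smul, E.cf_e hC hX, smul_eq_mul]
  split_ifs with h
  · rw [h, mul_one]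
  · rw [mul_zero]
    by_cases hsub : C ⊆ X
    · rw [minor, dif_neg]
      have := Finset.card_lt_card (hsub.ssubset_of_ne (Ne.symm h))
      omega
    · obtain ⟨c, hc, hcX⟩ := Finset.not_subset.1 hsub
      exact minor_eq_zero_of_row hc fun t ht => hu t ht c hcX

end ExtBasis

/-! ### Laplace expansion -/

lemma prod_sort_range_succ {N : Type*} [Monoid N] (f : ℕ → N) {T : Finset ℕ} {m : ℕ}
    (hT : T ⊆ range m) :
    (((insert m T).sort (· ≤ ·)).map f).prod = ((T.sort (· ≤ ·)).map f).prod * f m := by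
  have h : (insert m T).sort (· ≤ ·) = T.sort (· ≤ ·) ++ [m] := by
    apply List.Perm.eq_of_pairwise (le := (· ≤ ·))
    · intro a b _ _ h1 h2
      exact le_antisymm h1 h2
    · exact Finset.pairwise_sort _ _
    · rw [List.pairwise_append]
      refine ⟨Finset.pairwise_sort _ _, List.pairwise_singleton _ _, fun a ha b hb => ?_⟩
      rw [Finset.mem_sort] at ha
      rw [List.mem_singleton] at hb
      exact hb ▸ (mem_range.1 (hT ha)).le
    · have hm : m ∉ T := fun h => by simpa using hT h
      rw [List.perm_ext_iff_of_nodup (Finset.sort_nodup _ _)]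
      · intro a
        simp [or_comm]
      · rw [List.nodup_append]
        refine ⟨Finset.sort_nodup _ _, List.nodup_singleton _, fun a ha b hb => ?_⟩
        rw [Finset.mem_sort] at ha
        rw [List.mem_singleton] at hb
        rintro rfl
        exact hm (hb ▸ ha)
  rw [h, List.map_append, List.prod_append]
  simp

/-- Expansion of an ordered product of sums of anticommuting elements. -/
lemma prod_range_add {S N : Type*} [CommRing S] [Ring N] [Algebra S N] (a b : ℕ → N)
    (hab : ∀ s t, b s * a t = -(a t * b s)) (m : ℕ) :
    (((range m).sort (· ≤ ·)).map fun t => a t + b t).prod =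
      ∑ T ∈ (range m).powerset, ((-1 : S) ^ (T.card * (T.card + 1) / 2 + (∑ s ∈ T, s) + T.card)) •
        (((T.sort (· ≤ ·)).map a).prod * (((range m \ T).sort (· ≤ ·)).map b).prod) := by
  have hcomm : ∀ (k : ℕ) (l : List ℕ), (l.map b).prod * a k =
      ((-1 : S) ^ l.length) • (a k * (l.map b).prod) := by
    intro k l
    induction l with
    | nil => simp
    | cons t l ih =>
      rw [List.map_cons, List.prod_cons, mul_assoc, ih, mul_smul_comm, ← mul_assoc, hab,
        List.length_cons, pow_succ, neg_mul, smul_neg, mul_neg_one, neg_smul, mul_assoc]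
  induction m with
  | zero => simp
  | succ m ih =>
    rw [Finset.range_add_one, prod_sort_range_succ _ (Finset.Subset.refl _), ih,
      Finset.sum_powerset_insert Finset.notMem_range_self, mul_add, add_comm, Finset.sum_mul,
      Finset.sum_mul]
    congr 1
    · refine Finset.sum_congr rfl fun T hT => ?_
      have hT := mem_powerset.1 hT
      have hm : m ∉ T := fun h => by simpa using hT h
      rw [Finset.insert_sdiff_of_notMem _ hm, prod_sort_range_succ _ Finset.sdiff_subset,
        smul_mul_assoc, mul_assoc]
    · refine Finset.sum_congr rfl fun T hT => ?_
      have hT := mem_powerset.1 hT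
      have hm : m ∉ T := fun h => by simpa using hT h
      have h1 : insert m (range m) \ insert m T = range m \ T := by
        ext c
        simp only [mem_sdiff, mem_insert, mem_range]
        constructor
        · rintro ⟨h1 | h1, h2⟩
          · exact absurd (Or.inl h1) h2
          · exact ⟨h1, fun h => h2 (Or.inr h)⟩
        · rintro ⟨h1, h2⟩
          exact ⟨Or.inr h1, fun h => h.elim (fun h => by omega) h2⟩
      have hlen : ((range m \ T).sort (· ≤ ·)).length + T.card = m := by
        rw [Finset.length_sort, Finset.card_sdiff_of_subset hT, Finset.card_range]
        have := Finset.card_le_card hT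
        rw [Finset.card_range] at this
        omega
      rw [h1, prod_sort_range_succ _ hT, smul_mul_assoc, mul_assoc, hcomm, mul_smul_comm,
        smul_smul, mul_assoc, Finset.card_insert_of_notMem hm, Finset.sum_insert hm, ← pow_add]
      congr 1
      have htri := Nat.triangle_succ (T.card + 1)
      simp only [Nat.add_sub_cancel] at htri
      rw [mul_comm (T.card + 1) (T.card + 1 + 1), htri, mul_comm (T.card + 1) T.card]
      set l := ((range m \ T).sort (· ≤ ·)).length
      have : T.card * (T.card + 1) / 2 + (T.card + 1) + (m + ∑ s ∈ T, s) + (T.card + 1) =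
        (T.card * (T.card + 1) / 2 + ∑ s ∈ T, s + T.card + l) + 2 * (T.card + 1) := by omega
      rw [this, pow_add _ _ (2 * (T.card + 1)), pow_mul, neg_one_sq, one_pow, mul_one]

namespace ExtBasis

variable {S N : Type*} [CommRing S] [Ring N] [Algebra S N] {n : ℕ} (E : ExtBasis S N n)

lemma y_mul_sum (d : ℕ) (a : ℕ → S) (s : Finset ℕ) :
    E.y d * (∑ c ∈ s, a c • E.y c) = -((∑ c ∈ s, a c • E.y c) * E.y d) := by
  rw [Finset.mul_sum, Finset.sum_mul, ← Finset.sum_neg_distrib]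
  refine Finset.sum_congr rfl fun c _ => ?_
  rw [mul_smul_comm, smul_mul_assoc, E.swap, smul_neg]

lemma sum_mul_sum (a b : ℕ → S) (s : Finset ℕ) :
    (∑ c ∈ s, b c • E.y c) * (∑ c ∈ s, a c • E.y c) =
      -((∑ c ∈ s, a c • E.y c) * ∑ c ∈ s, b c • E.y c) := by
  rw [Finset.sum_mul (s := s), Finset.mul_sum (s := s) (f := fun c => b c • E.y c),
    ← Finset.sum_neg_distrib]
  refine Finset.sum_congr rfl fun c _ => ?_
  rw [smul_mul_assoc, y_mul_sum, mul_smul_comm, smul_neg]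

lemma e_mul_e {B C : Finset ℕ} (h : Disjoint B C) :
    E.e B * E.e C = E.e (B ∪ C) ∨ E.e B * E.e C = -E.e (B ∪ C) := by
  rw [e, e, ← word_append]
  have := E.word_of_nodup (l := B.sort (· ≤ ·) ++ C.sort (· ≤ ·)) (by
    rw [List.nodup_append]
    refine ⟨Finset.sort_nodup _ _, Finset.sort_nodup _ _, fun a ha b hb => ?_⟩
    rw [Finset.mem_sort] at ha hb
    exact fun hab => Finset.disjoint_left.1 h ha (hab ▸ hb))
  simpa using this

/-- Laplace expansion of a determinant along the rows in `B`. -/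
lemma laplace (E : ExtBasis S N n) {m : ℕ} (hm : m ≤ n) {B : Finset ℕ} (hB : B ⊆ range m) :
    ∃ ε : S, (ε = 1 ∨ ε = -1) ∧ ∀ u : ℕ → ℕ → S,
      ∑ T ∈ (range m).powersetCard B.card,
        ((-1 : S) ^ (B.card * (B.card + 1) / 2 + (∑ s ∈ T, s) + B.card)) *
          (minor u B T * minor u (range m \ B) (range m \ T)) =
      ε * minor u (range m) (range m) := by
  obtain ⟨ε, hε, he⟩ : ∃ ε : S, (ε = 1 ∨ ε = -1) ∧ E.e B * E.e (range m \ B) = ε • E.e (range m) := by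
    have := E.e_mul_e (B := B) (C := range m \ B) Finset.disjoint_sdiff
    rw [Finset.union_sdiff_of_subset hB] at this
    rcases this with h | h
    · exact ⟨1, Or.inl rfl, by rw [h, one_smul]⟩
    · exact ⟨-1, Or.inr rfl, by rw [h, neg_smul, one_smul]⟩
  refine ⟨ε, hε, fun u => ?_⟩
  have hmn : range m ⊆ range n := Finset.range_subset_range.2 hm
  have hBn : B ⊆ range n := hB.trans hmn
  have hB'n : range m \ B ⊆ range n := Finset.sdiff_subset.trans hmn
  set ua : ℕ → ℕ → S := fun t c => if c ∈ B then u t c else 0 with hua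
  set ub : ℕ → ℕ → S := fun t c => if c ∈ range m \ B then u t c else 0 with hub
  set um : ℕ → ℕ → S := fun t c => if c ∈ range m then u t c else 0 with hum
  have hsum : (fun t => (∑ c ∈ range n, ua t c • E.y c) + ∑ c ∈ range n, ub t c • E.y c) =
      fun t => ∑ c ∈ range n, um t c • E.y c := by
    funext t
    rw [← Finset.sum_add_distrib]
    refine Finset.sum_congr rfl fun c _ => ?_
    rw [← add_smul]
    congr 1
    simp only [hua, hub, hum, mem_sdiff]
    by_cases h1 : c ∈ B
    · simp [h1, hB h1]
    · simp [h1]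
  have hexp := prod_range_add (S := S) (fun t => ∑ c ∈ range n, ua t c • E.y c)
    (fun t => ∑ c ∈ range n, ub t c • E.y c) (fun s t => E.sum_mul_sum _ _ _) m
  rw [hsum] at hexp
  replace hexp : E.sprod um (range m) = ∑ T ∈ (range m).powerset,
      ((-1 : S) ^ (T.card * (T.card + 1) / 2 + (∑ s ∈ T, s) + T.card)) •
        (E.sprod ua T * E.sprod ub (range m \ T)) := hexp
  have hum' : ∀ R T : Finset ℕ, R ⊆ range m → minor um R T = minor u R T := fun R T hR =>
    minor_congr fun t _ c hc => if_pos (hR hc)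
  have hua' : ∀ T : Finset ℕ, minor ua B T = minor u B T := fun T =>
    minor_congr fun t _ c hc => if_pos hc
  have hub' : ∀ T : Finset ℕ, minor ub (range m \ B) T = minor u (range m \ B) T := fun T =>
    minor_congr fun t _ c hc => if_pos hc
  have hterm : ∀ T ∈ (range m).powerset, T ∉ (range m).powersetCard B.card →
      ((-1 : S) ^ (T.card * (T.card + 1) / 2 + (∑ s ∈ T, s) + T.card)) •
        (E.sprod ua T * E.sprod ub (range m \ T)) = 0 := by
    intro T hT hT'
    have hT := mem_powerset.1 hT
    have hcard : T.card ≠ B.card := fun h => hT' (mem_powersetCard.2 ⟨hT, h⟩)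
    have h1 := Finset.card_sdiff_of_subset hT
    have h2 := Finset.card_sdiff_of_subset hB
    have h3 := Finset.card_le_card hT
    have h4 := Finset.card_le_card hB
    rcases lt_or_gt_of_ne hcard with h | h
    · rw [E.sprod_of_support ub hB'n (fun t _ c hc => if_neg hc) (by omega), minor,
        dif_neg (by omega), zero_smul, mul_zero, smul_zero]
    · rw [E.sprod_of_support ua hBn (fun t _ c hc => if_neg hc) (by omega), minor,
        dif_neg (by omega), zero_smul, zero_mul, smul_zero]
  rw [← Finset.sum_subset (fun T hT => mem_powerset.2 (mem_powersetCard.1 hT).1) hterm] at hexp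
  have hcf := congrArg (E.cf (range m)) hexp
  rw [E.cf_sprod _ _ hmn, hum' _ _ (Finset.Subset.refl _), map_sum] at hcf
  rw [hcf, Finset.mul_sum]
  refine Finset.sum_congr rfl fun T hT => ?_
  obtain ⟨hT, hcard⟩ := mem_powersetCard.1 hT
  have h1 := Finset.card_sdiff_of_subset hT
  have h2 := Finset.card_sdiff_of_subset hB
  rw [E.sprod_of_support ua hBn (fun t _ c hc => if_neg hc) (by omega),
    E.sprod_of_support ub hB'n (fun t _ c hc => if_neg hc) (by omega), hua', hub', smul_mul_smul_comm,
    he, map_smul, map_smul, map_smul, E.cf_e hmn hmn, if_pos rfl, hcard]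
  have hεε : ε * ε = 1 := by rcases hε with h | h <;> rw [h] <;> ring
  simp only [smul_eq_mul, mul_one]
  linear_combination (-((-1 : S) ^ (B.card * (B.card + 1) / 2 + (∑ s ∈ T, s) + B.card)) *
    (minor u B T * minor u (range m \ B) (range m \ T))) * hεε

end ExtBasis

lemma minor_eq_det {S : Type*} [CommRing S] (u : ℕ → ℕ → S) {R C : Finset ℕ} {k : ℕ}
    (hR : R.card = k) (hC : C.card = k) :
    minor u R C = Matrix.det (Matrix.of fun i j : Fin k =>
      u (C.orderEmbOfFin hC j) (R.orderEmbOfFin hR i : ℕ)) := by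
  subst hR
  rw [minor, dif_pos hC]

namespace ExtBasis

variable {S N : Type*} [CommRing S] [Ring N] [Algebra S N] {n : ℕ} (E : ExtBasis S N n)

/-- The sum defining Mui's element, evaluated at linear combinations `∑ c < m, v t c • y c`. -/
lemma sum_minor_smul_sprod {m : ℕ} (hm : m ≤ n) {B : Finset ℕ} (hB : B ⊆ range m)
    (v : ℕ → ℕ → S) :
    ∃ ε : S, (ε = 1 ∨ ε = -1) ∧
      ∑ T ∈ (range m).powersetCard B.card,
        ((-1 : S) ^ (B.card * (B.card + 1) / 2 + (∑ s ∈ T, s) + B.card)) •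
          (minor v (range m \ B) (range m \ T) •
            E.sprod (fun t c => if c < m then v t c else 0) T) =
      (ε * minor v (range m) (range m)) • E.e B := by
  obtain ⟨ε, hε, hlap⟩ := E.laplace hm hB
  refine ⟨ε, hε, E.ext_cf fun C hC => ?_⟩
  have hBn : B ⊆ range n := hB.trans (Finset.range_subset_range.2 hm)
  rw [map_sum, map_smul, E.cf_e hC hBn, smul_eq_mul]
  simp only [map_smul, smul_eq_mul, E.cf_sprod _ _ hC]
  by_cases hCm : C ⊆ range m
  · have hres : ∀ T, minor (fun t c => if c < m then v t c else 0) C T = minor v C T := fun T =>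
      minor_congr fun t _ c hc => if_pos (mem_range.1 (hCm hc))
    simp only [hres]
    by_cases hcard : C.card = B.card
    · set κ : ℕ → ℕ := fun c => if h : c ∈ B then
        C.orderEmbOfFin hcard ((B.orderIsoOfFin rfl).symm ⟨c, h⟩) else c with hκ
      have hκB : ∀ c ∈ B, κ c ∈ C := by
        intro c hc
        simp only [hκ, dif_pos hc]
        exact Finset.orderEmbOfFin_mem ..
      have hκE : ∀ i, κ (B.orderEmbOfFin rfl i) = C.orderEmbOfFin hcard i := by
        intro i
        have h : B.orderEmbOfFin rfl i ∈ B := Finset.orderEmbOfFin_mem ..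
        simp only [hκ, dif_pos h]
        congr 1
        rw [OrderIso.symm_apply_eq]
        rfl
      have hκn : ∀ c, c ∉ B → κ c = c := fun c hc => by simp only [hκ, dif_neg hc]
      have h := hlap fun t c => v t (κ c)
      have h1 : ∀ T ∈ (range m).powersetCard B.card, minor (fun t c => v t (κ c)) B T = minor v C T := by
        intro T hT
        have hT := (mem_powersetCard.1 hT).2
        rw [minor_eq_det _ rfl hT, minor_eq_det _ hcard hT]
        simp only [hκE]
      have h2 : ∀ T, minor (fun t c => v t (κ c)) (range m \ B) T = minor v (range m \ B) T := fun T =>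
        minor_congr fun t _ c hc => by rw [hκn c (mem_sdiff.1 hc).2]
      rw [Finset.sum_congr rfl fun T hT => by rw [h1 T hT, h2, mul_comm (minor v C T)]] at h
      rw [h]
      split_ifs with hBC
      · rw [mul_one]
        congr 1
        refine minor_congr fun t _ c _ => ?_
        by_cases hc : c ∈ B
        · subst hBC
          have : κ c = c := by
            simp only [hκ, dif_pos hc]
            exact congrArg Subtype.val ((B.orderIsoOfFin rfl).apply_symm_apply ⟨c, hc⟩)
          rw [this]
        · rw [hκn c hc]
      · rw [mul_zero]
        have hns : ¬ C ⊆ B := fun h => hBC (Finset.eq_of_subset_of_card_le h hcard.ge).symm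
        obtain ⟨d, hdC, hdB⟩ := Finset.not_subset.1 hns
        obtain ⟨i, hi⟩ : d ∈ Set.range (C.orderEmbOfFin hcard) := by simpa using hdC
        have hiB : B.orderEmbOfFin rfl i ∈ B := Finset.orderEmbOfFin_mem ..
        rw [minor_eq_zero_of_rows_eq (hB hiB) (hCm hdC), mul_zero]
        · rintro rfl
          exact hdB hiB
        · intro t _
          rw [hκE, hi, hκn d hdB]
    · rw [if_neg (fun h => hcard (by rw [h])), mul_zero]
      refine Finset.sum_eq_zero fun T hT => ?_
      have h0 : minor v C T = 0 :=
        dif_neg (fun h => hcard (by rw [← h, (mem_powersetCard.1 hT).2]))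
      rw [h0, mul_zero, mul_zero]
  · rw [if_neg (by rintro rfl; exact hCm hB), mul_zero]
    obtain ⟨c, hc, hcm⟩ := Finset.not_subset.1 hCm
    refine Finset.sum_eq_zero fun T _ => ?_
    rw [minor_eq_zero_of_row hc fun t _ => if_neg (fun h => hcm (mem_range.2 h)), mul_zero, mul_zero]

end ExtBasis

/-! ### Linearized polynomials -/

section Linearized

variable {F R : Type*} [Fintype F] [CommRing R]

variable (F) in
/-- The monic `F`-linear polynomial of degree `q ^ m` vanishing on `u 0, …, u (m - 1)`. -/
def linPoly (u : ℕ → R) : ℕ → R → R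
  | 0, x => x
  | m + 1, x => linPoly u m x ^ Fintype.card F -
      linPoly u m (u m) ^ (Fintype.card F - 1) * linPoly u m x

variable (F) in
lemma linPoly_eq_zero [Nonempty F] (u : ℕ → R) {t m : ℕ} (h : t < m) : linPoly F u m (u t) = 0 := by
  have hq : 0 < Fintype.card F := Fintype.card_pos
  induction m with
  | zero => omega
  | succ m ih =>
    simp only [linPoly]
    rcases Nat.lt_succ_iff_lt_or_eq.1 h with h | rfl
    · rw [ih h, zero_pow hq.ne', mul_zero, sub_zero]
    · rw [← pow_succ, Nat.sub_add_cancel hq, sub_self]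

variable (F) in
lemma linPoly_comp (u : ℕ → R) (m a : ℕ) (x : R) :
    linPoly F (fun t => linPoly F u m (u (m + t))) a (linPoly F u m x) = linPoly F u (m + a) x := by
  induction a generalizing x with
  | zero => rfl
  | succ a ih =>
    simp only [linPoly, ih]
    rfl

variable [Field F] [Algebra F R]

lemma prod_add_algebraMap_mul [IsDomain R] (A Y : R) :
    ∏ b : F, (algebraMap F R b * A + Y) =
      Y ^ Fintype.card F - A ^ (Fintype.card F - 1) * Y := by
  have hq : 1 < Fintype.card F := Fintype.one_lt_card
  rcases eq_or_ne A 0 with rfl | hA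
  · simp [zero_pow (Nat.sub_ne_zero_of_lt hq)]
  have hpoly : ∏ b : F, (Polynomial.X - Polynomial.C b) =
      (Polynomial.X ^ Fintype.card F - Polynomial.X : Polynomial F) := by
    have hm : (Polynomial.X ^ Fintype.card F - Polynomial.X : Polynomial F).Monic :=
      Polynomial.monic_X_pow_sub (by rw [Polynomial.degree_X]; exact_mod_cast hq)
    have := Polynomial.prod_multiset_X_sub_C_of_monic_of_roots_card_eq hm (by
      rw [FiniteField.roots_X_pow_card_sub_X, FiniteField.X_pow_card_sub_X_natDegree_eq F hq]
      rfl)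
    rw [FiniteField.roots_X_pow_card_sub_X] at this
    exact this
  let K := FractionRing R
  have hA' : algebraMap R K A ≠ 0 := by
    rw [Ne, FaithfulSMul.algebraMap_eq_zero_iff]
    exact hA
  set y := algebraMap R K Y
  set a := algebraMap R K A
  have h := congrArg (Polynomial.aeval (y / a)) hpoly
  rw [map_prod, map_sub, map_pow, Polynomial.aeval_X, ← Equiv.prod_comp (Equiv.neg F)] at h
  simp only [Equiv.neg_apply, map_neg, sub_neg_eq_add, map_add, Polynomial.aeval_X,
    Polynomial.aeval_C] at h
  apply FaithfulSMul.algebraMap_injective R K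
  rw [map_prod, map_sub, map_mul, map_pow, map_pow]
  have hfac : ∀ b : F, algebraMap R K (algebraMap F R b * A + Y) =
      a * (y / a + algebraMap F K b) := by
    intro b
    rw [map_add, map_mul, ← IsScalarTower.algebraMap_apply, mul_add, mul_div_cancel₀ _ hA',
      add_comm, mul_comm a]
  simp only [hfac]
  rw [Finset.prod_mul_distrib, h, Finset.prod_const, Finset.card_univ, mul_sub, ← mul_pow,
    mul_div_cancel₀ _ hA']
  obtain ⟨k, hk⟩ : ∃ k, Fintype.card F = k + 1 := ⟨_, (Nat.sub_add_cancel hq.le).symm⟩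
  rw [hk, pow_succ a, mul_assoc (a ^ k), mul_div_cancel₀ _ hA', Nat.add_sub_cancel]

variable (F) in
lemma linPoly_expand (u : ℕ → R) (m : ℕ) :
    ∃ d : ℕ → R, d m = 1 ∧ (∀ c, m < c → d c = 0) ∧
      ∀ x, linPoly F u m x = ∑ c ∈ range (m + 1), d c * x ^ Fintype.card F ^ c := by
  induction m with
  | zero => exact ⟨fun c => if c = 0 then 1 else 0, by simp, by simp; omega, by simp [linPoly]⟩
  | succ m ih =>
    obtain ⟨d, hd1, hd2, hd⟩ := ih
    set A := linPoly F u m (u m) ^ (Fintype.card F - 1)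
    refine ⟨fun c => (if c = 0 then 0 else d (c - 1) ^ Fintype.card F) - A * d c, ?_, ?_, ?_⟩
    · simp [hd1, hd2 (m + 1) (by omega)]
    · intro c hc
      have : Fintype.card F ≠ 0 := Fintype.card_ne_zero
      simp [show c ≠ 0 by omega, hd2 c (by omega), hd2 (c - 1) (by omega), this]
    · intro x
      have hfr : (∑ c ∈ range (m + 1), d c * x ^ Fintype.card F ^ c) ^ Fintype.card F =
          ∑ c ∈ range (m + 1), d c ^ Fintype.card F * x ^ Fintype.card F ^ (c + 1) := by
        have := map_sum (FiniteField.frobeniusAlgHom F R)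
          (fun c => d c * x ^ Fintype.card F ^ c) (range (m + 1))
        simp only [FiniteField.coe_frobeniusAlgHom] at this
        rw [this]
        refine Finset.sum_congr rfl fun c _ => ?_
        rw [mul_pow, ← pow_mul, ← pow_succ]
      simp only [linPoly]
      rw [hd x, hfr]
      simp only [sub_mul, Finset.sum_sub_distrib]
      congr 1
      · rw [Finset.sum_range_succ' _ (m + 1)]
        simp
      · rw [Finset.sum_range_succ _ (m + 1), hd2 (m + 1) (by omega), Finset.mul_sum]
        simp [mul_assoc, A]

variable (F) in
lemma linPoly_add (u : ℕ → R) (m : ℕ) (x y : R) :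
    linPoly F u m (x + y) = linPoly F u m x + linPoly F u m y := by
  induction m with
  | zero => rfl
  | succ m ih =>
    have := map_add (FiniteField.frobeniusAlgHom F R) (linPoly F u m x) (linPoly F u m y)
    simp only [FiniteField.coe_frobeniusAlgHom] at this
    simp only [linPoly]
    rw [ih, this]
    ring

lemma linPoly_algebraMap_mul (u : ℕ → R) (m : ℕ) (b : F) (x : R) :
    linPoly F u m (algebraMap F R b * x) = algebraMap F R b * linPoly F u m x := by
  induction m with
  | zero => rfl
  | succ m ih =>
    simp only [linPoly]
    rw [ih, mul_pow, ← map_pow, FiniteField.pow_card]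
    ring

lemma linPoly_eq_prod [IsDomain R] (u : ℕ → R) (m : ℕ) (x : R) :
    linPoly F u m x = ∏ c : Fin m → F, ((∑ k : Fin m, algebraMap F R (c k) * u k) + x) := by
  induction m generalizing x with
  | zero => simp [linPoly]
  | succ m ih =>
    rw [← (Fin.snocEquiv fun _ => F).prod_comp, Fintype.prod_prod_type]
    simp only [linPoly]
    rw [← prod_add_algebraMap_mul (F := F)]
    refine Finset.prod_congr rfl fun b _ => ?_
    rw [← linPoly_algebraMap_mul, ← linPoly_add, ih]
    refine Finset.prod_congr rfl fun c _ => ?_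
    rw [Fin.sum_univ_castSucc]
    simp [Fin.snocEquiv, add_assoc]

variable (F) in
/-- The Moore determinant as a product of values of linearized polynomials. -/
lemma minor_pow_eq_prod (u : ℕ → R) (m : ℕ) :
    minor (fun t c => u t ^ Fintype.card F ^ c) (range m) (range m) =
      ∏ c ∈ range m, linPoly F u c (u c) := by
  choose d hd1 hd2 hd using linPoly_expand F u
  have hr : ∀ i : Fin m, (range m).orderEmbOfFin (Finset.card_range m) i = i := by
    intro i
    rw [← Finset.orderEmbOfFin_unique (Finset.card_range m) (f := fun i : Fin m => (i : ℕ))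
      (fun i => mem_range.2 i.2) (fun i j h => h)]
  rw [minor_eq_det _ (Finset.card_range m) (Finset.card_range m)]
  simp only [hr]
  set A : Matrix (Fin m) (Fin m) R := Matrix.of fun i j => u j ^ Fintype.card F ^ (i : ℕ)
  set U : Matrix (Fin m) (Fin m) R := Matrix.of fun i c => d i c
  have hUA : ∀ i j, (U * A) i j = linPoly F u i (u j) := by
    intro i j
    rw [Matrix.mul_apply, hd]
    simp only [U, A, Matrix.of_apply]
    rw [← Finset.sum_range (fun c => d i c * u j ^ Fintype.card F ^ c)]
    symm
    refine Finset.sum_subset (Finset.range_subset_range.2 i.2) fun c _ hc => ?_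
    rw [hd2 i c (by simpa using hc), zero_mul]
  have hU : U.det = 1 := by
    rw [Matrix.det_of_isLowerTriangular U fun i j hij => hd2 _ _ hij]
    exact Finset.prod_eq_one fun i _ => hd1 i
  have hdet : (U * A).det = ∏ c ∈ range m, linPoly F u c (u c) := by
    rw [Matrix.det_of_isUpperTriangular fun i j hij => ?_, Finset.prod_range]
    · exact Finset.prod_congr rfl fun i _ => hUA i i
    · rw [hUA]
      exact linPoly_eq_zero F u hij
  rw [← hdet, Matrix.det_mul, hU, one_mul]

variable (F) in
lemma exists_pow_eq_sum (u : ℕ → R) (m c' : ℕ) :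
    ∃ a : ℕ → R, (∀ t < m, u t ^ Fintype.card F ^ c' =
      ∑ c ∈ range m, a c * u t ^ Fintype.card F ^ c) := by
  obtain ⟨d, hd1, hd2, hd⟩ := linPoly_expand F u m
  induction c' with
  | zero =>
    rcases Nat.eq_zero_or_pos m with rfl | hm
    · exact ⟨0, by simp⟩
    · refine ⟨fun c => if c = 0 then 1 else 0, fun t _ => ?_⟩
      rw [Finset.sum_eq_single 0] <;> simp +contextual
      omega
  | succ c' ih =>
    obtain ⟨a, ha⟩ := ih
    rcases m with _ | m
    · exact ⟨0, by simp⟩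
    refine ⟨fun c => (if c = 0 then 0 else a (c - 1) ^ Fintype.card F) -
      a m ^ Fintype.card F * d c, fun t ht => ?_⟩
    have h0 := linPoly_eq_zero F u ht
    rw [hd, Finset.sum_range_succ, hd1, one_mul] at h0
    rw [pow_succ, pow_mul, ha t ht]
    have := map_sum (FiniteField.frobeniusAlgHom F R)
      (fun c => a c * u t ^ Fintype.card F ^ c) (range (m + 1))
    simp only [FiniteField.coe_frobeniusAlgHom] at this
    rw [this]
    simp only [mul_pow, ← pow_mul, ← pow_succ, sub_mul, Finset.sum_sub_distrib, mul_assoc]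
    rw [← Finset.mul_sum, Finset.sum_range_succ, Finset.sum_range_succ' _ m]
    simp only [Nat.add_sub_cancel, if_neg (Nat.succ_ne_zero _), if_true, zero_mul, add_zero]
    linear_combination a m ^ Fintype.card F * h0

lemma eq_zero_of_sum_mul_pow [IsDomain R] (u : ℕ → R) {m q : ℕ}
    (h0 : minor (fun t c => u t ^ q ^ c) (range m) (range m) ≠ 0)
    {a : ℕ → R} (h : ∀ t < m, ∑ c ∈ range m, a c * u t ^ q ^ c = 0) :
    ∀ c < m, a c = 0 := by
  have hr : ∀ i : Fin m, (range m).orderEmbOfFin (Finset.card_range m) i = i := by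
    intro i
    rw [← Finset.orderEmbOfFin_unique (Finset.card_range m) (f := fun i : Fin m => (i : ℕ))
      (fun i => mem_range.2 i.2) (fun i j h => h)]
  rw [minor_eq_det _ (Finset.card_range m) (Finset.card_range m)] at h0
  simp only [hr] at h0
  have := Matrix.eq_zero_of_vecMul_eq_zero h0 (v := fun i => a i) (by
    funext j
    rw [Matrix.vecMul, dotProduct, Pi.zero_apply, ← h j j.2, Finset.sum_range]
    rfl)
  exact fun c hc => congrFun this ⟨c, hc⟩

end Linearized

/-! ### The map `y t ↦ ∑ c, x t ^ q ^ c • y c` and its tower -/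

namespace ExtBasis

section Lift

variable {S N : Type*} [CommRing S] [Ring N] [Algebra S N] {n : ℕ} (E : ExtBasis S N n)

lemma algHom_ext {φ ψ : N →ₐ[S] N} (h : ∀ c < n, φ (E.y c) = ψ (E.y c)) : φ = ψ := by
  have hw : ∀ l : List ℕ, φ (E.word l) = ψ (E.word l) := by
    intro l
    induction l with
    | nil => simp
    | cons t l ih =>
      rw [word_cons, map_mul, map_mul, ih]
      rcases lt_or_ge t n with ht | ht
      · rw [h t ht]
      · rw [E.zero_of_le t ht, map_zero, map_zero]
  ext f
  rw [← E.sum_cf f, map_sum, map_sum]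
  exact Finset.sum_congr rfl fun B _ => by rw [map_smul, map_smul, e, hw]

/-- Every linear substitution of the generators extends to an algebra endomorphism. -/
def HasLift : Prop :=
  ∀ A : ℕ → ℕ → S, ∃ φ : N →ₐ[S] N, ∀ t < n, φ (E.y t) = ∑ c ∈ range n, A t c • E.y c

variable {E}

/-- The algebra endomorphism extending a linear substitution of the generators. -/
def HasLift.map (hE : E.HasLift) (A : ℕ → ℕ → S) : N →ₐ[S] N := (hE A).choose

lemma HasLift.map_y (hE : E.HasLift) (A : ℕ → ℕ → S) {t : ℕ} (ht : t < n) :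
    hE.map A (E.y t) = ∑ c ∈ range n, A t c • E.y c := (hE A).choose_spec t ht

lemma HasLift.map_injective [IsDomain S] (hE : E.HasLift) {A : ℕ → ℕ → S}
    (hA : (Matrix.of fun i j : Fin n => A i j).det ≠ 0) : Function.Injective (hE.map A) := by
  set M := Matrix.of fun i j : Fin n => A i j with hM
  set Ψ := hE.map fun c d => if h : c < n ∧ d < n then M.adjugate ⟨c, h.1⟩ ⟨d, h.2⟩ else 0 with hΨ
  have hy : ∀ t, Ψ (hE.map A (E.y t)) = M.det • E.y t := by
    intro t
    rcases lt_or_ge t n with ht | ht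
    · rw [hE.map_y A ht, map_sum, Finset.sum_range]
      have h1 : ∀ c : Fin n, Ψ (A t c • E.y c) = ∑ d : Fin n, (M ⟨t, ht⟩ c * M.adjugate c d) • E.y d := by
        intro c
        rw [map_smul, hΨ, hE.map_y _ c.2, Finset.sum_range, Finset.smul_sum]
        refine Finset.sum_congr rfl fun d _ => ?_
        rw [dif_pos ⟨c.2, d.2⟩, smul_smul]
        rfl
      simp only [h1]
      rw [Finset.sum_comm]
      simp only [← Finset.sum_smul, ← Matrix.mul_apply, Matrix.mul_adjugate]
      rw [Finset.sum_eq_single ⟨t, ht⟩]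
      · simp
      · intro d _ hd
        simp [hd.symm]
      · simp
    · rw [E.zero_of_le t ht, map_zero, map_zero, smul_zero]
  have hw : ∀ l : List ℕ, Ψ (hE.map A (E.word l)) = M.det ^ l.length • E.word l := by
    intro l
    induction l with
    | nil => simp
    | cons t l ih =>
      rw [word_cons, map_mul, map_mul, ih, hy, smul_mul_smul_comm, List.length_cons, pow_succ']
  rw [injective_iff_map_eq_zero]
  intro f hf
  have hz : Ψ (hE.map A f) = 0 := by rw [hf, map_zero]
  rw [← E.sum_cf f, map_sum, map_sum] at hz
  refine E.ext_cf fun B hB => ?_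
  have hz' : ∑ B ∈ (range n).powerset, (M.det ^ B.card * E.cf B f) • E.e B = 0 := by
    rw [← hz]
    refine Finset.sum_congr rfl fun B _ => ?_
    rw [map_smul, map_smul, e, hw, Finset.length_sort, smul_smul, mul_comm]
  have := congrArg (E.cf B) hz'
  rw [E.cf_sum hB, map_zero] at this
  rw [map_zero]
  exact (mul_eq_zero.1 this).resolve_left (pow_ne_zero _ hA)

end Lift

section Tower

variable {F S N : Type*} [Field F] [Fintype F] [CommRing S] [Algebra F S] [Ring N]
  [Algebra S N] {n : ℕ} {E : ExtBasis S N n}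

variable (F) in
/-- Coefficients expressing `x t ^ q ^ c'`, for `t < m`, through `x t ^ q ^ c` with `c < m`. -/
def coef (x : ℕ → S) (m c' c : ℕ) : S :=
  if c' < m then (if c' = c then 1 else 0) else (exists_pow_eq_sum F x m c').choose c

lemma coef_of_lt (x : ℕ → S) {m c' : ℕ} (h : c' < m) (c : ℕ) :
    coef F x m c' c = if c' = c then 1 else 0 := if_pos h

lemma sum_coef (x : ℕ → S) (m c' : ℕ) {t : ℕ} (ht : t < m) :
    ∑ c ∈ range m, coef F x m c' c * x t ^ Fintype.card F ^ c = x t ^ Fintype.card F ^ c' := by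
  by_cases h : c' < m
  · simp [coef_of_lt x h, h]
  · rw [(exists_pow_eq_sum F x m c').choose_spec t ht]
    simp [coef, h]

variable (F) in
/-- The Moore determinants of `x` do not vanish. -/
def Regular (x : ℕ → S) (n : ℕ) : Prop :=
  ∀ m ≤ n, minor (fun t c => x t ^ Fintype.card F ^ c) (range m) (range m) ≠ 0

lemma coef_unique [IsDomain S] {x : ℕ → S} (hx : Regular F x n) {m c' : ℕ} (hm : m ≤ n)
    {b : ℕ → S} (hb : ∀ t < m, ∑ c ∈ range m, b c * x t ^ Fintype.card F ^ c =
      x t ^ Fintype.card F ^ c') {c : ℕ} (hc : c < m) : b c = coef F x m c' c := by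
  have := eq_zero_of_sum_mul_pow x (hx m hm) (a := fun c => b c - coef F x m c' c) (fun t ht => by
    simp only [sub_mul, Finset.sum_sub_distrib]
    rw [hb t ht, sum_coef x m c' ht, sub_self]) c hc
  exact sub_eq_zero.1 this

variable (F) in
/-- The maps `y c ↦ ∑ c' < n, coef m c' c • y c'` for `c < m`. -/
def HasLift.tower (hE : E.HasLift) (x : ℕ → S) (m : ℕ) : N →ₐ[S] N :=
  hE.map fun c c' => if c < m then coef F x m c' c else if c = c' then 1 else 0

lemma HasLift.tower_y (hE : E.HasLift) (x : ℕ → S) {m c : ℕ} (hc : c < m) (hm : m ≤ n) :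
    hE.tower F x m (E.y c) = ∑ c' ∈ range n, coef F x m c' c • E.y c' := by
  rw [HasLift.tower, hE.map_y _ (hc.trans_le hm)]
  simp only [if_pos hc]

variable (F) in
/-- The map `y t ↦ ∑ c < n, x t ^ q ^ c • y c`. -/
def HasLift.frob (hE : E.HasLift) (x : ℕ → S) : N →ₐ[S] N :=
  hE.map fun t c => x t ^ Fintype.card F ^ c

lemma HasLift.isTower [IsDomain S] (hE : E.HasLift) {x : ℕ → S} (hx : Regular F x n) :
    E.IsTower (hE.tower F x) where
  last := by
    refine E.algHom_ext fun c hc => ?_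
    rw [hE.tower_y x hc le_rfl, Finset.sum_eq_single c]
    · rw [coef_of_lt x hc, if_pos rfl, one_smul]
      rfl
    · intro d hd hdc
      rw [coef_of_lt x (mem_range.1 hd), if_neg hdc, zero_smul]
    · intro h
      exact absurd (mem_range.2 hc) h
  trans := by
    intro j m hjm hmn
    refine ⟨hE.map fun c c' => if c' < m then coef F x j c' c else 0, fun c hc => ?_⟩
    have hφ : hE.map (fun c c' => if c' < m then coef F x j c' c else 0) (E.y c) =
        ∑ d ∈ range m, coef F x j d c • E.y d := by
      rw [hE.map_y _ (by omega)]
      symm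
      refine Finset.sum_subset_zero_on_sdiff (Finset.range_subset_range.2 hmn) ?_ ?_
      · intro d hd
        have := (mem_sdiff.1 hd).2
        rw [if_neg (by simpa using this), zero_smul]
      · intro d hd
        rw [if_pos (mem_range.1 hd)]
    rw [hφ]
    constructor
    · rw [map_sum, hE.tower_y x hc (hjm.trans hmn)]
      have h1 : ∀ d ∈ range m, hE.tower F x m (coef F x j d c • E.y d) =
          ∑ c' ∈ range n, (coef F x m c' d * coef F x j d c) • E.y c' := by
        intro d hd
        rw [map_smul, hE.tower_y x (mem_range.1 hd) hmn, Finset.smul_sum]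
        refine Finset.sum_congr rfl fun c' _ => ?_
        rw [smul_smul, mul_comm]
      rw [Finset.sum_congr rfl h1, Finset.sum_comm]
      refine Finset.sum_congr rfl fun c' _ => ?_
      rw [← Finset.sum_smul]
      congr 1
      symm
      refine coef_unique hx (hjm.trans hmn) (b := fun c => ∑ d ∈ range m, coef F x m c' d * coef F x j d c)
        (fun t ht => ?_) hc
      simp only [Finset.sum_mul]
      rw [Finset.sum_comm]
      simp only [mul_assoc, ← Finset.mul_sum]
      simp only [sum_coef x j _ ht]
      exact sum_coef x m c' (ht.trans_le hjm)
    · rw [← Finset.sum_erase_add _ _ (mem_range.2 (hc.trans_le hjm)), coef_of_lt x hc, if_pos rfl,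
        one_smul, add_sub_cancel_right]
      refine Submodule.sum_mem _ fun d hd => ?_
      obtain ⟨hdc, hd⟩ := mem_erase.1 hd
      by_cases hdj : d < j
      · rw [coef_of_lt x hdj, if_neg hdc, zero_smul]
        exact Submodule.zero_mem _
      · exact Submodule.smul_mem _ _
          (E.fil_mono le_rfl (by omega) (E.y_mem_fil (mem_range.1 hd)))

lemma HasLift.frob_y (hE : E.HasLift) (x : ℕ → S) {t m : ℕ} (ht : t < m) (hm : m ≤ n) :
    hE.frob F x (E.y t) =
      hE.tower F x m (∑ c ∈ range m, x t ^ Fintype.card F ^ c • E.y c) := by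
  rw [HasLift.frob, hE.map_y _ (ht.trans_le hm), map_sum]
  have h1 : ∀ c ∈ range m, hE.tower F x m (x t ^ Fintype.card F ^ c • E.y c) =
      ∑ c' ∈ range n, (coef F x m c' c * x t ^ Fintype.card F ^ c) • E.y c' := by
    intro c hc
    rw [map_smul, hE.tower_y x (mem_range.1 hc) hm, Finset.smul_sum]
    refine Finset.sum_congr rfl fun c' _ => ?_
    rw [smul_smul, mul_comm]
  rw [Finset.sum_congr rfl h1, Finset.sum_comm]
  refine Finset.sum_congr rfl fun c' _ => ?_
  rw [← Finset.sum_smul, sum_coef x m c' ht]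

variable (F) in
/-- Mui's element attached to `B`. -/
def mui (E : ExtBasis S N n) (x : ℕ → S) (m : ℕ) (B : Finset ℕ) : N :=
  ∑ T ∈ (range m).powersetCard B.card,
    ((-1 : S) ^ (B.card * (B.card + 1) / 2 + (∑ s ∈ T, s) + B.card)) •
      (minor (fun t c => x t ^ Fintype.card F ^ c) (range m \ B) (range m \ T) • E.e T)

lemma HasLift.frob_mui [IsDomain S] (hE : E.HasLift) (x : ℕ → S) {m : ℕ} (hm : m ≤ n)
    {B : Finset ℕ} (hB : B ⊆ range m) :
    ∃ ε : S, (ε = 1 ∨ ε = -1) ∧ hE.frob F x (E.mui F x m B) =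
      (ε * ∏ a ∈ range m, linPoly F x a (x a)) • hE.tower F x m (E.e B) := by
  obtain ⟨ε, hε, h⟩ := E.sum_minor_smul_sprod hm hB fun t c => x t ^ Fintype.card F ^ c
  refine ⟨ε, hε, ?_⟩
  rw [← minor_pow_eq_prod, ← map_smul, ← h, mui, map_sum, map_sum]
  refine Finset.sum_congr rfl fun T hT => ?_
  have hT := (mem_powersetCard.1 hT).1
  rw [map_smul, map_smul, map_smul, map_smul, e, word, map_list_prod, sprod, map_list_prod,
    List.map_map, List.map_map]
  congr 3
  refine List.map_congr_left fun t ht => ?_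
  rw [Function.comp_apply, Function.comp_apply,
    hE.frob_y x (mem_range.1 (hT ((Finset.mem_sort _).1 ht))) hm]
  congr 1
  refine Finset.sum_subset_zero_on_sdiff (Finset.range_subset_range.2 hm) ?_ ?_
  · intro d hd
    have := (mem_sdiff.1 hd).2
    rw [if_neg (by simpa using this), zero_smul]
  · intro d hd
    rw [if_pos (mem_range.1 hd)]

end Tower

lemma HasLift.frob_injective {F S N : Type*} [Fintype F] [CommRing S] [IsDomain S] [Ring N]
    [Algebra S N] {n : ℕ} {E : ExtBasis S N n} (hE : E.HasLift) {x : ℕ → S}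
    (hx : Regular F x n) :
    Function.Injective (hE.frob F x) := by
  refine hE.map_injective ?_
  have h := hx n le_rfl
  have hr : ∀ i : Fin n, (range n).orderEmbOfFin (Finset.card_range n) i = i := by
    intro i
    rw [← Finset.orderEmbOfFin_unique (Finset.card_range n) (f := fun i : Fin n => (i : ℕ))
      (fun i => mem_range.2 i.2) (fun i j h => h)]
  rw [minor_eq_det _ (Finset.card_range n) (Finset.card_range n), ← Matrix.det_transpose] at h
  simp only [hr] at h
  exact h

end ExtBasis

/-! ### Equivariance -/

namespace ExtBasis

section Semilinear

variable {S N : Type*} [CommRing S] [Ring N] [Algebra S N] {n : ℕ} {E : ExtBasis S N n}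

/-- `ρ` acts through `σ` on the coefficients and fixes the generators. -/
structure ActsOnCoeffs (E : ExtBasis S N n) (σ : S →+* S) (ρ : N →+* N) : Prop where
  smul : ∀ s f, ρ (s • f) = σ s • ρ f
  map_y : ∀ t, ρ (E.y t) = E.y t

variable {σ : S →+* S} {ρ : N →+* N}

lemma ActsOnCoeffs.map_e (h : E.ActsOnCoeffs σ ρ) (B : Finset ℕ) : ρ (E.e B) = E.e B := by
  rw [e, word, map_list_prod, List.map_map]
  congr 2
  exact funext fun t => h.map_y t

lemma ActsOnCoeffs.cf_map (h : E.ActsOnCoeffs σ ρ) {B : Finset ℕ} (hB : B ⊆ range n) (f : N) :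
    E.cf B (ρ f) = σ (E.cf B f) := by
  conv_lhs => rw [← E.sum_cf f, map_sum]
  simp only [h.smul, h.map_e]
  exact E.cf_sum hB

lemma ActsOnCoeffs.map_eq_self_iff (h : E.ActsOnCoeffs σ ρ) (f : N) :
    ρ f = f ↔ ∀ B ⊆ range n, σ (E.cf B f) = E.cf B f := by
  constructor
  · intro hf B hB
    rw [← h.cf_map hB, hf]
  · intro hf
    exact E.ext_cf fun B hB => by rw [h.cf_map hB, hf B hB]

end Semilinear

section Equivariance

variable {F S N : Type*} [Field F] [Fintype F] [CommRing S] [Algebra F S] [Ring N]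
  [Algebra S N] {n : ℕ} {E : ExtBasis S N n} {x : ℕ → S} {σ : S →ₐ[F] S} {ρ : N →+* N}

lemma algebraMap_pow_card_pow (a : F) (c : ℕ) :
    (algebraMap F S a) ^ Fintype.card F ^ c = algebraMap F S a := by
  rw [← map_pow, FiniteField.pow_card_pow]

variable (F) in
lemma sum_pow_card_pow {ι : Type*} (s : Finset ι) (f : ι → S) (c : ℕ) :
    (∑ i ∈ s, f i) ^ Fintype.card F ^ c = ∑ i ∈ s, f i ^ Fintype.card F ^ c := by
  induction c with
  | zero => simp
  | succ c ih =>
    rw [pow_succ, pow_mul, ih]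
    simp only [pow_mul]
    have := map_sum (FiniteField.frobeniusAlgHom F S) (fun i => f i ^ Fintype.card F ^ c) s
    simpa only [FiniteField.coe_frobeniusAlgHom] using this

lemma map_coef [IsDomain S] (hx : Regular F x n) {m : ℕ} (hm : m ≤ n)
    (hσ : ∀ t < m, ∃ a : ℕ → F, x t = ∑ s ∈ range m, algebraMap F S (a s) * σ (x s))
    (c' : ℕ) {c : ℕ} (hc : c < m) : σ (coef F x m c' c) = coef F x m c' c := by
  refine coef_unique hx hm (b := fun c => σ (coef F x m c' c)) (fun t ht => ?_) hc
  obtain ⟨a, ha⟩ := hσ t ht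
  have hpow : ∀ d, x t ^ Fintype.card F ^ d =
      ∑ s ∈ range m, algebraMap F S (a s) * σ (x s) ^ Fintype.card F ^ d := by
    intro d
    rw [ha, sum_pow_card_pow]
    exact Finset.sum_congr rfl fun s _ => by rw [mul_pow, algebraMap_pow_card_pow]
  simp only [hpow, Finset.mul_sum]
  rw [Finset.sum_comm]
  refine Finset.sum_congr rfl fun s hs => ?_
  rw [← map_pow σ, ← sum_coef x m c' (mem_range.1 hs), map_sum, Finset.mul_sum]
  refine Finset.sum_congr rfl fun d _ => ?_
  rw [map_mul, map_pow]
  ring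

lemma HasLift.map_tower_e [IsDomain S] (hE : E.HasLift) (hx : Regular F x n)
    (hρ : E.ActsOnCoeffs σ ρ) {m : ℕ} (hm : m ≤ n)
    (hσ : ∀ t < m, ∃ a : ℕ → F, x t = ∑ s ∈ range m, algebraMap F S (a s) * σ (x s))
    {B : Finset ℕ} (hB : B ⊆ range m) : ρ (hE.tower F x m (E.e B)) = hE.tower F x m (E.e B) := by
  rw [e, word, map_list_prod, map_list_prod, List.map_map,
    List.map_map, List.map_map]
  refine congrArg List.prod ?_
  refine List.map_congr_left fun c hc => ?_
  have hc : c < m := mem_range.1 (hB ((Finset.mem_sort _).1 hc))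
  simp only [Function.comp_apply]
  rw [hE.tower_y x hc hm, map_sum]
  refine Finset.sum_congr rfl fun c' _ => ?_
  rw [hρ.smul, hρ.map_y, RingHom.coe_coe, map_coef hx hm hσ c' hc]

lemma HasLift.map_theta [IsDomain S] (hE : E.HasLift) (hx : Regular F x n)
    (hρ : E.ActsOnCoeffs σ ρ) {M : Set ℕ} (hM : n ∈ M)
    (hσ : ∀ m ∈ M, ∀ t < m, ∃ a : ℕ → F,
      x t = ∑ s ∈ range m, algebraMap F S (a s) * σ (x s)) (f : N) :
    ρ (E.theta M (hE.tower F x) f) = E.theta M (hE.tower F x) (ρ f) := by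
  rw [theta_apply, theta_apply, map_sum]
  refine Finset.sum_congr rfl fun B hB => ?_
  have hB := mem_powerset.1 hB
  obtain ⟨h1, h2⟩ := lev_spec hM hB
  rw [hρ.smul, hρ.cf_map hB, hE.map_tower_e hx hρ (lev_le hM hB) (hσ _ h1) h2]

lemma HasLift.frob_comm (hE : E.HasLift) (hρ : E.ActsOnCoeffs σ ρ) {τ : N →+* N}
    (hτ : ∀ s f, τ (s • f) = σ s • τ f) {g : ℕ → ℕ → F}
    (hτy : ∀ t < n, τ (E.y t) = ∑ s ∈ range n, algebraMap F S (g s t) • E.y s)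
    (hσ : ∀ t < n, σ (x t) = ∑ s ∈ range n, algebraMap F S (g s t) * x s) (f : N) :
    hE.frob F x (τ f) = ρ (hE.frob F x f) := by
  have hy : ∀ t, hE.frob F x (τ (E.y t)) = ρ (hE.frob F x (E.y t)) := by
    intro t
    rcases lt_or_ge t n with ht | ht
    · rw [hτy t ht, map_sum, HasLift.frob, hE.map_y _ ht, map_sum]
      have h1 : ∀ s ∈ range n, hE.map (fun t c => x t ^ Fintype.card F ^ c)
          (algebraMap F S (g s t) • E.y s) =
          ∑ c ∈ range n, (algebraMap F S (g s t) * x s) ^ Fintype.card F ^ c • E.y c := by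
        intro s hs
        rw [map_smul, hE.map_y _ (mem_range.1 hs), Finset.smul_sum]
        refine Finset.sum_congr rfl fun c _ => ?_
        rw [smul_smul, mul_pow, algebraMap_pow_card_pow]
      rw [Finset.sum_congr rfl h1, Finset.sum_comm]
      refine Finset.sum_congr rfl fun c _ => ?_
      rw [← Finset.sum_smul, hρ.smul, hρ.map_y, RingHom.coe_coe, map_pow, hσ t ht,
        sum_pow_card_pow]
    · rw [E.zero_of_le t ht, map_zero, map_zero, map_zero]
  have hw : ∀ l : List ℕ, hE.frob F x (τ (E.word l)) = ρ (hE.frob F x (E.word l)) := by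
    intro l
    induction l with
    | nil => simp
    | cons t l ih => rw [word_cons, map_mul, map_mul, map_mul, map_mul, ih, hy]
  rw [← E.sum_cf f, map_sum, map_sum, map_sum, map_sum]
  refine Finset.sum_congr rfl fun B _ => ?_
  rw [hτ, map_smul, map_smul, hρ.smul, e, hw, RingHom.coe_coe]

/-- The `(q - 1)`-st power of the Moore determinant is invariant. -/
lemma map_prod_linPoly_pow [IsDomain S] {m : ℕ}
    (hσ : ∀ t < m, ∃ a : ℕ → F, x t = ∑ s ∈ range m, algebraMap F S (a s) * σ (x s))
    (h0 : ∏ a ∈ range m, linPoly F x a (x a) ≠ 0) :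
    σ ((∏ a ∈ range m, linPoly F x a (x a)) ^ (Fintype.card F - 1)) =
      (∏ a ∈ range m, linPoly F x a (x a)) ^ (Fintype.card F - 1) := by
  have hr : ∀ i : Fin m, (range m).orderEmbOfFin (Finset.card_range m) i = i := by
    intro i
    rw [← Finset.orderEmbOfFin_unique (Finset.card_range m) (f := fun i : Fin m => (i : ℕ))
      (fun i => mem_range.2 i.2) (fun i j h => h)]
  have hL : ∏ a ∈ range m, linPoly F x a (x a) =
      (Matrix.of fun i j : Fin m => x j ^ Fintype.card F ^ (i : ℕ)).det := by
    rw [← minor_pow_eq_prod, minor_eq_det _ (Finset.card_range m) (Finset.card_range m)]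
    simp only [hr]
  choose! a ha using hσ
  set A : Matrix (Fin m) (Fin m) F := Matrix.of fun s t : Fin m => a t s with hA
  have hmul : (Matrix.of fun i j : Fin m => x j ^ Fintype.card F ^ (i : ℕ)) =
      σ.toRingHom.mapMatrix (Matrix.of fun i j : Fin m => x j ^ Fintype.card F ^ (i : ℕ)) *
        (algebraMap F S).mapMatrix A := by
    ext i j
    rw [Matrix.mul_apply, Matrix.of_apply, ha j j.2, sum_pow_card_pow, Finset.sum_range]
    refine Finset.sum_congr rfl fun s _ => ?_
    simp [hA, mul_pow, algebraMap_pow_card_pow, mul_comm]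
  have hdet : ∏ a ∈ range m, linPoly F x a (x a) =
      σ (∏ a ∈ range m, linPoly F x a (x a)) * algebraMap F S A.det := by
    rw [hL]
    conv_lhs => rw [hmul, Matrix.det_mul]
    rw [RingHom.map_det, ← RingHom.map_det]
    rfl
  have hA0 : A.det ≠ 0 := by
    intro h
    rw [h, map_zero, mul_zero] at hdet
    exact h0 hdet
  conv_rhs => rw [hdet, mul_pow, ← map_pow (algebraMap F S), FiniteField.pow_card_sub_one_eq_one _ hA0,
    map_one, mul_one]
  rw [map_pow]

end Equivariance

end ExtBasis

/-! ### Divisibility of coefficients of invariants -/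

namespace ExtBasis

section Transvection

variable {S N : Type*} [CommRing S] [Ring N] [Algebra S N] {n : ℕ} {E : ExtBasis S N n}

/-- `f` is fixed by a semilinear transvection `y t ↦ y t + y s`, whose action on the coefficients
is trivial modulo `x`. -/
def FixedByTransvection (E : ExtBasis S N n) (x : S) (s t : ℕ) (f : N) : Prop :=
  ∃ (σ : S →+* S) (τ : N →+* N), (∀ p, x ∣ p - σ p) ∧ (∀ p u, τ (p • u) = σ p • τ u) ∧
    τ (E.y t) = E.y t + E.y s ∧ (∀ c < n, c ≠ t → τ (E.y c) = E.y c) ∧ τ f = f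

lemma FixedByTransvection.dvd_cf (hE : E.HasLift) {x : S} {s t : ℕ} {f : N}
    (h : E.FixedByTransvection x s t f) (hs : s < n) (ht : t < n) (hst : s ≠ t) {B : Finset ℕ}
    (hB : B ⊆ range n) (htB : t ∈ B) (hsB : s ∉ B) : x ∣ E.cf B f := by
  obtain ⟨σ, τ, hσ, hτ, hτt, hτc, hτf⟩ := h
  set φ := hE.map fun c d => if c = d then 1 else if c = t ∧ d = s then 1 else 0 with hφ
  have hφτ : ∀ c, φ (E.y c) = τ (E.y c) := by
    intro c
    rcases lt_or_ge c n with hc | hc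
    · rw [hφ, hE.map_y _ hc]
      by_cases hct : c = t
      · subst hct
        rw [hτt, Finset.sum_eq_add_of_mem c s (mem_range.2 hc) (mem_range.2 hs) hst.symm]
        · simp
        · rintro d - ⟨h1, h2⟩
          simp [h1.symm, h2]
      · rw [hτc c hc hct, Finset.sum_eq_single_of_mem c (mem_range.2 hc)]
        · simp
        · intro d _ hd
          simp [hct, hd.symm]
    · rw [E.zero_of_le c hc, map_zero, map_zero]
  have hφe : ∀ B, φ (E.e B) = τ (E.e B) := by
    intro B
    rw [e, word, map_list_prod, map_list_prod, List.map_map, List.map_map]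
    exact congrArg List.prod (List.map_congr_left fun c _ => hφτ c)
  choose w hw using fun B => hσ (E.cf B f)
  refine E.dvd_cf_of_transvection φ hst hs (by rw [hφτ, hτt]) (fun c hc => ?_)
    (u := ∑ B ∈ (range n).powerset, w B • φ (E.e B)) ?_ hB htB hsB
  · rcases lt_or_ge c n with hcn | hcn
    · rw [hφτ, hτc c hcn hc]
    · rw [E.zero_of_le c hcn, map_zero]
  · have h1 : φ f = ∑ B ∈ (range n).powerset, E.cf B f • φ (E.e B) := by
      conv_lhs => rw [← E.sum_cf f, map_sum]
      exact Finset.sum_congr rfl fun B _ => map_smul _ _ _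
    have h2 : f = ∑ B ∈ (range n).powerset, σ (E.cf B f) • φ (E.e B) := by
      conv_lhs => rw [← hτf, ← E.sum_cf f, map_sum]
      exact Finset.sum_congr rfl fun B _ => by rw [hτ, hφe]
    conv_lhs => rw [h1]; rhs; rw [h2]
    rw [← Finset.sum_sub_distrib, Finset.smul_sum]
    refine Finset.sum_congr rfl fun B _ => ?_
    rw [← sub_smul, hw, mul_smul]

end Transvection

variable {F S N : Type*} [Field F] [Fintype F] [CommRing S] [IsDomain S] [Algebra F S] [Ring N]
  [Algebra S N] {n : ℕ} {E : ExtBasis S N n} {x : ℕ → S}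

lemma HasLift.dvd_cf (hE : E.HasLift) (hx : Regular F x n) {M : Set ℕ} (hM : n ∈ M) {m s : ℕ}
    (hm : m ∈ M) (hmn : m ≤ n) (hs : s < n) {f h : N}
    (hh : E.theta M (hE.tower F x) h = hE.frob F x f)
    (hf : ∀ t < n, m ≤ t → s ≠ t → E.FixedByTransvection (x s) s t f) {B : Finset ℕ}
    (hB : B ⊆ range n) (hBm : ¬ B ⊆ range m) : x s ∣ E.cf B h := by
  refine (hE.isTower hx).dvd_cf hM hm hmn (hE.frob F x) (s := s)
    (u := ∑ c ∈ range n, x s ^ (Fintype.card F ^ c - 1) • E.y c) ?_ (fun t ht => ?_) hh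
    (fun B hB hBm hsB => ?_) hB hBm
  · rw [HasLift.frob, hE.map_y _ hs, Finset.smul_sum]
    refine Finset.sum_congr rfl fun c _ => ?_
    rw [smul_smul, mul_pow_sub_one (pow_ne_zero _ Fintype.card_ne_zero)]
  · exact ⟨_, Submodule.sum_mem _ fun c hc => Submodule.smul_mem _ _
      (E.fil_mono le_rfl (Nat.zero_le c) (E.y_mem_fil (mem_range.1 hc))), hE.frob_y x ht hmn⟩
  · obtain ⟨t, ht, htm⟩ := Finset.not_subset.1 hBm
    have htn := mem_range.1 (hB ht)
    have hst : s ≠ t := fun h => hsB (h ▸ ht)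
    exact (hf t htn (by simpa using htm) hst).dvd_cf hE hs htn hst hB ht hsB

end ExtBasis

/-! ### Polynomials divisible by powers of linear forms -/

section LinearForms

variable {F : Type} [Field F] {n : ℕ}

/-- The linear form `x s + ∑ k < s, c k x k`. -/
def linForm (F : Type) [Field F] (n : ℕ) (s : ℕ) (c : Fin s → F) : SV F n :=
  (∑ k : Fin s, MvPolynomial.C (c k) * xV F n k) + xV F n s

lemma xV_of_lt {a : ℕ} (h : a < n) : xV F n a = X ⟨a, h⟩ := dif_pos h

/-- The substitution `x s ↦ x s + ∑ k < s, c k x k`. -/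
def shift (n : ℕ) (s : ℕ) (c : Fin s → F) : SV F n →ₐ[F] SV F n :=
  MvPolynomial.aeval fun j => if (j : ℕ) = s then linForm F n s c else X j

lemma shift_xV {s : ℕ} (hs : s < n) (c : Fin s → F) : shift n s c (xV F n s) = linForm F n s c := by
  rw [xV_of_lt hs, shift, aeval_X, if_pos rfl]

lemma shift_xV_of_ne {s : ℕ} (c : Fin s → F) {t : ℕ} (ht : t ≠ s) :
    shift n s c (xV F n t) = xV F n t := by
  by_cases h : t < n
  · rw [xV_of_lt h, shift, aeval_X, if_neg ht]
  · rw [xV, dif_neg h, map_zero]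

lemma shift_shift {s : ℕ} (hs : s < n) (c d : Fin s → F) :
    (shift n s c).comp (shift n s d) = shift n s (c + d) := by
  refine MvPolynomial.algHom_ext fun j => ?_
  rw [AlgHom.comp_apply, ← xV_of_lt j.2]
  by_cases hj : (j : ℕ) = s
  · rw [hj, shift_xV hs, shift_xV hs, linForm, map_add, map_sum, shift_xV hs, linForm, linForm,
      ← add_assoc, ← Finset.sum_add_distrib]
    congr 1
    refine Finset.sum_congr rfl fun k _ => ?_
    rw [map_mul, shift_xV_of_ne c k.2.ne, MvPolynomial.algHom_C, MvPolynomial.algebraMap_eq,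
      Pi.add_apply, map_add]
    ring
  · rw [shift_xV_of_ne _ hj, shift_xV_of_ne _ hj, shift_xV_of_ne _ hj]

lemma shift_zero (s : ℕ) : shift n s (0 : Fin s → F) = AlgHom.id F _ := by
  refine MvPolynomial.algHom_ext fun j => ?_
  rw [← xV_of_lt j.2]
  by_cases hj : (j : ℕ) = s
  · rw [hj, shift_xV (hj ▸ j.2)]
    simp [linForm]
  · rw [shift_xV_of_ne _ hj]
    rfl

lemma irreducible_linForm {s : ℕ} (hs : s < n) (c : Fin s → F) : Irreducible (linForm F n s c) := by
  let φ : SV F n ≃ₐ[F] SV F n := AlgEquiv.ofAlgHom (shift n s c) (shift n s (-c))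
    (by rw [shift_shift hs, add_neg_cancel, shift_zero])
    (by rw [shift_shift hs, neg_add_cancel, shift_zero])
  have : φ (xV F n s) = linForm F n s c := shift_xV hs c
  rw [← this, MulEquiv.irreducible_iff, xV_of_lt hs]
  exact (X_prime).irreducible

lemma eval_linForm {s : ℕ} (hs : s < n) (c : Fin s → F) (v : ℕ → F) :
    MvPolynomial.eval (fun j : Fin n => v j) (linForm F n s c) = (∑ k : Fin s, c k * v k) + v s := by
  rw [linForm, map_add, map_sum, xV_of_lt hs, eval_X]
  congr 1
  refine Finset.sum_congr rfl fun k _ => ?_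
  rw [map_mul, xV_of_lt (k.2.trans hs), eval_X, eval_C]

lemma not_linForm_dvd {s t : ℕ} (hst : s ≤ t) (ht : t < n) (c : Fin s → F) (d : Fin t → F)
    (hne : (⟨s, c⟩ : Σ s : ℕ, Fin s → F) ≠ ⟨t, d⟩) : ¬ linForm F n s c ∣ linForm F n t d := by
  rintro ⟨u, hu⟩
  have key : ∀ v : ℕ → F, (∑ k : Fin s, c k * v k) + v s = 0 →
      (∑ k : Fin t, d k * v k) + v t = 0 := by
    intro v hv
    rw [← eval_linForm ht, hu, map_mul, eval_linForm (hst.trans_lt ht), hv, zero_mul]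
  rcases hst.lt_or_eq with h | rfl
  · have := key (fun k => if k = t then 1 else 0) (by
      rw [if_neg h.ne, add_zero]
      exact Finset.sum_eq_zero fun k _ => by rw [if_neg (by omega), mul_zero])
    rw [if_pos rfl, Finset.sum_eq_zero fun k _ => by rw [if_neg (by omega), mul_zero]] at this
    simp at this
  · obtain ⟨k, hk⟩ : ∃ k, c k ≠ d k := by
      by_contra! h
      exact hne (by rw [funext h])
    have hval : ∀ b : Fin s → F, (∑ j : Fin s, b j * (if (j : ℕ) = s then - c k else
        if (j : ℕ) = k then 1 else 0)) = b k := by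
      intro b
      rw [Finset.sum_eq_single k]
      · rw [if_neg k.2.ne, if_pos rfl, mul_one]
      · intro j _ hj
        rw [if_neg j.2.ne, if_neg (fun h => hj (Fin.ext h)), mul_zero]
      · simp
    have := key (fun j => if j = s then - c k else if j = k then 1 else 0) (by
      rw [hval, if_pos rfl, add_neg_cancel])
    rw [hval, if_pos rfl, ← sub_eq_add_neg, sub_eq_zero] at this
    exact hk this.symm

lemma isRelPrime_linForm {s t : ℕ} (hs : s < n) (ht : t < n) (c : Fin s → F) (d : Fin t → F)
    (hne : (⟨s, c⟩ : Σ s : ℕ, Fin s → F) ≠ ⟨t, d⟩) :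
    IsRelPrime (linForm F n s c) (linForm F n t d) := by
  rcases le_total s t with h | h
  · exact (irreducible_linForm hs c).isRelPrime_iff_not_dvd.2 (not_linForm_dvd h ht c d hne)
  · exact ((irreducible_linForm ht d).isRelPrime_iff_not_dvd.2
      (not_linForm_dvd h hs d c hne.symm)).symm

/-- The substitution `x s ↦ a x s`. -/
def dilate (n : ℕ) (s : ℕ) (a : F) : SV F n →ₐ[F] SV F n :=
  MvPolynomial.aeval fun j => if (j : ℕ) = s then MvPolynomial.C a * X j else X j

lemma coeff_dilate (s : Fin n) (a : F) (p : SV F n) (d : Fin n →₀ ℕ) :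
    coeff d (dilate n s a p) = a ^ d s * coeff d p := by
  induction p using MvPolynomial.induction_on' with
  | monomial u b =>
    have : dilate n s a (monomial u b) = monomial u (a ^ u s * b) := by
      rw [dilate, aeval_monomial, MvPolynomial.algebraMap_eq, Finsupp.prod_fintype _ _ (by simp),
        monomial_eq, Finsupp.prod_fintype _ _ (by simp),
        ← Finset.prod_erase_mul _ _ (Finset.mem_univ s),
        ← Finset.prod_erase_mul _ _ (Finset.mem_univ s), if_pos rfl, mul_pow, map_mul, map_pow]
      rw [Finset.prod_congr rfl fun j hj => by
        rw [if_neg fun h => (Finset.mem_erase.1 hj).1 (Fin.ext h)]]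
      ring
    rw [this, coeff_monomial, coeff_monomial]
    split_ifs with h
    · rw [h]
    · rw [mul_zero]
  | add p q hp hq => rw [map_add, coeff_add, coeff_add, hp, hq, mul_add]

lemma X_pow_dvd_of_coeff {s : Fin n} {k : ℕ} {p : SV F n} (h : ∀ d, coeff d p ≠ 0 → k ≤ d s) :
    X s ^ k ∣ p := by
  rw [p.as_sum]
  refine Finset.dvd_sum fun d hd => ?_
  rw [X_pow_eq_monomial, monomial_dvd_monomial]
  refine ⟨Or.inr ?_, one_dvd _⟩
  rw [Finsupp.single_le_iff]
  exact h d (mem_support_iff.1 hd)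

lemma one_le_of_X_dvd {s : Fin n} {p : SV F n} (h : X s ∣ p) {d : Fin n →₀ ℕ}
    (hd : coeff d p ≠ 0) : 1 ≤ d s := by
  obtain ⟨q, rfl⟩ := h
  rw [mul_comm, coeff_mul_X'] at hd
  by_contra hs
  exact hd (if_neg (by simpa using hs))

variable [Fintype F]

lemma xV_pow_dvd {s : ℕ} (hs : s < n) {p : SV F n} (hp : xV F n s ∣ p)
    (hinv : ∀ a : F, a ≠ 0 → dilate n s a p = p) : xV F n s ^ (Fintype.card F - 1) ∣ p := by
  rw [xV_of_lt hs] at *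
  refine X_pow_dvd_of_coeff fun d hd => ?_
  have h1 := one_le_of_X_dvd hp hd
  refine Nat.le_of_dvd h1 ((FiniteField.forall_pow_eq_one_iff F _).1 fun a => ?_)
  have := congrArg (coeff d) (hinv a a.ne_zero)
  rw [coeff_dilate ⟨s, hs⟩] at this
  ext
  simpa [hd] using this

lemma prod_linForm_pow_dvd {m : ℕ} (hm : m ≤ n) {p : SV F n} (hp : ∀ s < m, xV F n s ∣ p)
    (hdil : ∀ s < m, ∀ a : F, a ≠ 0 → dilate n s a p = p)
    (hshift : ∀ s < m, ∀ c : Fin s → F, shift n s c p = p) :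
    (∏ s ∈ range m, ∏ c : Fin s → F, linForm F n s c) ^ (Fintype.card F - 1) ∣ p := by
  have h1 : ∏ s ∈ range m, ∏ c : Fin s → F, linForm F n s c =
      ∏ z ∈ (range m).sigma fun s => (Finset.univ : Finset (Fin s → F)), linForm F n z.1 z.2 :=
    (Finset.prod_sigma _ _ fun z : Σ s : ℕ, Fin s → F => linForm F n z.1 z.2).symm
  rw [h1, ← Finset.prod_pow]
  refine Finset.prod_dvd_of_isRelPrime ?_ ?_
  · rintro ⟨s, c⟩ hs ⟨t, d⟩ ht hne
    have hs := mem_range.1 (Finset.mem_sigma.1 hs).1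
    have ht := mem_range.1 (Finset.mem_sigma.1 ht).1
    exact (isRelPrime_linForm (hs.trans_le hm) (ht.trans_le hm) c d hne).pow
  · rintro ⟨s, c⟩ hs
    have hs := mem_range.1 (Finset.mem_sigma.1 hs).1
    have := map_dvd (shift n s c) (xV_pow_dvd (hs.trans_le hm) (hp s hs) (hdil s hs))
    rwa [map_pow, shift_xV (hs.trans_le hm), hshift s hs] at this

end LinearForms

/-! ### The monomial basis of `S(V) ⊗ Λ(V)` -/

section Instance

variable (F : Type) [Field F] (n : ℕ)

lemma yV_of_lt {a : ℕ} (h : a < n) :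
    yV F n a = ExteriorAlgebra.ι F (Pi.single (⟨a, h⟩ : Fin n) (1 : F)) := dif_pos h

lemma yProd_map_val (s : Finset (Fin n)) :
    yProd F n (s.map Fin.valEmbedding) = (Pi.basisFun F (Fin n)).ExteriorAlgebra s := by
  rw [ExteriorAlgebra.basis_apply_ofCard _ rfl, ExteriorAlgebra.ιMulti_family,
    ExteriorAlgebra.ιMulti_apply, yProd,
    ← Finset.map_sort Fin.valEmbedding s (· ≤ ·) (· ≤ ·) fun a _ b _ => Iff.rfl, List.map_map,
    sort_map_eq_ofFn _ s rfl]
  congr 2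
  funext i
  simp only [Function.comp_apply, Fin.valEmbedding_apply, yV_of_lt F n (Fin.is_lt _),
    Pi.basisFun_apply]
  rfl

/-- The elements of `Fin n` lying in a finite set of natural numbers. -/
def finPart (B : Finset ℕ) : Finset (Fin n) := univ.filter fun t => (t : ℕ) ∈ B

variable {n} in
lemma map_finPart {B : Finset ℕ} (hB : B ⊆ range n) : (finPart n B).map Fin.valEmbedding = B := by
  ext t
  simp only [finPart, mem_map, mem_filter, mem_univ, true_and, Fin.valEmbedding_apply]
  constructor
  · rintro ⟨a, ha, rfl⟩
    exact ha
  · exact fun ht => ⟨⟨t, mem_range.1 (hB ht)⟩, ht, rfl⟩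

/-- The monomial basis of `S(V) ⊗ Λ(V)` over `S(V)`. -/
def slBasis : Module.Basis (Finset (Fin n)) (SV F n) (SL F n) :=
  Algebra.TensorProduct.basis (SV F n) (Pi.basisFun F (Fin n)).ExteriorAlgebra

lemma prod_map_one_tmul_yV (B : Finset ℕ) :
    ((B.sort (· ≤ ·)).map fun t => (1 : SV F n) ⊗ₜ[F] yV F n t).prod =
      (1 : SV F n) ⊗ₜ[F] yProd F n B := by
  have := map_list_prod (Algebra.TensorProduct.includeRight : LV F n →ₐ[F] SL F n)
    ((B.sort (· ≤ ·)).map (yV F n))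
  rw [List.map_map] at this
  exact this.symm

lemma prod_map_eq_slBasis {B : Finset ℕ} (hB : B ⊆ range n) :
    ((B.sort (· ≤ ·)).map fun t => (1 : SV F n) ⊗ₜ[F] yV F n t).prod =
      slBasis F n (finPart n B) := by
  rw [prod_map_one_tmul_yV, slBasis, Algebra.TensorProduct.basis_apply, ← yProd_map_val,
    map_finPart hB]

lemma yV_mul_self (t : ℕ) : yV F n t * yV F n t = 0 := by
  rw [yV]
  split_ifs
  · exact ExteriorAlgebra.ι_sq_zero _
  · exact zero_mul 0

lemma yV_swap (s t : ℕ) : yV F n s * yV F n t = -(yV F n t * yV F n s) := by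
  rw [yV, yV]
  split_ifs
  · exact eq_neg_of_add_eq_zero_left (ExteriorAlgebra.ι_add_mul_swap _ _)
  all_goals simp

/-- `S(V) ⊗ Λ(V)` with its generators `y`. -/
def slExt : ExtBasis (SV F n) (SL F n) n where
  y t := 1 ⊗ₜ yV F n t
  cf B := (slBasis F n).coord (finPart n B)
  sq t := by
    rw [Algebra.TensorProduct.tmul_mul_tmul, yV_mul_self, TensorProduct.tmul_zero]
  swap s t := by
    rw [Algebra.TensorProduct.tmul_mul_tmul, Algebra.TensorProduct.tmul_mul_tmul, yV_swap,
      TensorProduct.tmul_neg]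
  zero_of_le t ht := by
    rw [yV, dif_neg (by omega), TensorProduct.tmul_zero]
  cf_mon B B' hB hB' := by
    rw [prod_map_eq_slBasis F n hB', Module.Basis.coord_apply, Module.Basis.repr_self,
      Finsupp.single_apply]
    congr 1
    rw [eq_iff_iff]
    refine ⟨fun h => ?_, fun h => by rw [h]⟩
    rw [← map_finPart hB, ← map_finPart hB', h]
  sum_mon f := by
    conv_rhs => rw [← (slBasis F n).sum_repr f]
    refine Finset.sum_bij' (fun B _ => finPart n B) (fun s _ => s.map Fin.valEmbedding)
      (fun _ _ => mem_univ _) (fun s _ => ?_) (fun B hB => map_finPart (mem_powerset.1 hB))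
      (fun s _ => ?_) (fun B hB => ?_)
    · refine mem_powerset.2 fun t ht => ?_
      obtain ⟨a, -, rfl⟩ := mem_map.1 ht
      exact mem_range.2 a.2
    · ext t
      simp [finPart, Fin.val_inj]
    · rw [prod_map_eq_slBasis F n (mem_powerset.1 hB), Module.Basis.coord_apply]

lemma slExt_y (t : ℕ) : (slExt F n).y t = (1 : SV F n) ⊗ₜ[F] yV F n t := rfl

lemma slExt_e (B : Finset ℕ) : (slExt F n).e B = (1 : SV F n) ⊗ₜ[F] yProd F n B :=
  prod_map_one_tmul_yV F n B

lemma slExt_hasLift : (slExt F n).HasLift := by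
  intro A
  let l : (Fin n → F) →ₗ[F] SL F n := Fintype.linearCombination F
    fun t : Fin n => ∑ c ∈ range n, A t c • (slExt F n).y c
  have hl : ∀ v, l v * l v = 0 := by
    intro v
    have : l v = ∑ c ∈ range n, (∑ t : Fin n, MvPolynomial.C (v t) * A t c) • (slExt F n).y c := by
      simp only [l, Fintype.linearCombination_apply, Finset.smul_sum, Finset.sum_smul]
      rw [Finset.sum_comm]
      refine Finset.sum_congr rfl fun c _ => Finset.sum_congr rfl fun t _ => ?_
      rw [mul_smul, ← MvPolynomial.algebraMap_eq, algebraMap_smul]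
    rw [this]
    exact (slExt F n).sq_sum _ _
  let ψ : LV F n →ₐ[F] SL F n := ExteriorAlgebra.lift F ⟨l, hl⟩
  have hcomm : ∀ a b, Commute (Algebra.ofId (SV F n) (SL F n) a) (ψ b) :=
    fun a b => Algebra.commutes a (ψ b)
  refine ⟨Algebra.TensorProduct.lift (Algebra.ofId _ _) ψ hcomm, fun t ht => ?_⟩
  rw [slExt_y, Algebra.TensorProduct.lift_tmul, map_one, one_mul, yV_of_lt F n ht,
    ExteriorAlgebra.lift_ι_apply]
  simp [l, Fintype.linearCombination_apply, Pi.single_apply]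

end Instance

/-! ### The actions on `S(V) ⊗ Λ(V)` -/

section Actions

lemma tensorMap_smul {F A B : Type*} [CommRing F] [CommRing A] [Ring B] [Algebra F A] [Algebra F B]
    (φ : A →ₐ[F] A) (ψ : B →ₐ[F] B) (p : A) (f : A ⊗[F] B) :
    Algebra.TensorProduct.map φ ψ (p • f) = φ p • Algebra.TensorProduct.map φ ψ f := by
  rw [Algebra.smul_def, Algebra.smul_def, map_mul, Algebra.TensorProduct.algebraMap_apply,
    Algebra.TensorProduct.algebraMap_apply, Algebra.TensorProduct.map_tmul, map_one]
  rfl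

variable {F : Type} [Field F] {n : ℕ}

/-- The action of a matrix on `S(V) ⊗ Λ(V)` through the first factor. -/
def coeffAct (g : Matrix (Fin n) (Fin n) F) : SL F n →ₐ[F] SL F n :=
  Algebra.TensorProduct.map (gAct F n g) (AlgHom.id F _)

lemma actsOnCoeffs (g : Matrix (Fin n) (Fin n) F) :
    (slExt F n).ActsOnCoeffs (gAct F n g : SV F n →+* SV F n) (coeffAct g : SL F n →+* SL F n) where
  smul := tensorMap_smul _ _
  map_y t := by
    rw [slExt_y, RingHom.coe_coe, coeffAct, Algebra.TensorProduct.map_tmul, map_one]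
    rfl

lemma tAct_smul (g : Matrix (Fin n) (Fin n) F) (p : SV F n) (f : SL F n) :
    tAct F n g (p • f) = gAct F n g p • tAct F n g f := tensorMap_smul _ _ _ _

/-- The entry of a matrix, with junk value `0` out of range. -/
def entry (g : Matrix (Fin n) (Fin n) F) (s t : ℕ) : F :=
  if h : s < n ∧ t < n then g ⟨s, h.1⟩ ⟨t, h.2⟩ else 0

lemma entry_of_lt (g : Matrix (Fin n) (Fin n) F) {s t : ℕ} (hs : s < n) (ht : t < n) :
    entry g s t = g ⟨s, hs⟩ ⟨t, ht⟩ := dif_pos ⟨hs, ht⟩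

lemma gAct_xV (g : Matrix (Fin n) (Fin n) F) {t : ℕ} (ht : t < n) :
    gAct F n g (xV F n t) = ∑ s ∈ range n, algebraMap F (SV F n) (entry g s t) * xV F n s := by
  rw [xV_of_lt ht, gAct, aeval_X, Finset.sum_range]
  refine Finset.sum_congr rfl fun s _ => ?_
  rw [entry_of_lt g s.2 ht, xV_of_lt s.2, MvPolynomial.algebraMap_eq]

lemma tAct_y (g : Matrix (Fin n) (Fin n) F) {t : ℕ} (ht : t < n) :
    tAct F n g ((slExt F n).y t) =
      ∑ s ∈ range n, algebraMap F (SV F n) (entry g s t) • (slExt F n).y s := by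
  rw [slExt_y, tAct, Algebra.TensorProduct.map_tmul, map_one, eAct, yV_of_lt F n ht,
    ExteriorAlgebra.map_apply_ι, Finset.sum_range]
  have : g.mulVecLin (Pi.single ⟨t, ht⟩ 1) = ∑ s : Fin n, g s ⟨t, ht⟩ • Pi.single s (1 : F) := by
    rw [Matrix.mulVecLin_apply, Matrix.mulVec_single_one]
    ext i
    simp [Finset.sum_apply, Pi.single_apply]
  rw [this, map_sum, TensorProduct.tmul_sum]
  refine Finset.sum_congr rfl fun s _ => ?_
  rw [map_smul, slExt_y, yV_of_lt F n s.2, entry_of_lt g s.2 ht, TensorProduct.tmul_smul,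
    algebraMap_smul]

lemma gAct_X (g : Matrix (Fin n) (Fin n) F) (j : Fin n) :
    gAct F n g (X j) = ∑ i, MvPolynomial.C (g i j) * X i := aeval_X _ _

lemma gAct_gAct (g h : Matrix (Fin n) (Fin n) F) (p : SV F n) :
    gAct F n g (gAct F n h p) = gAct F n (g * h) p := by
  rw [← AlgHom.comp_apply]
  congr 1
  refine MvPolynomial.algHom_ext fun j => ?_
  rw [AlgHom.comp_apply, gAct_X, gAct_X, map_sum]
  simp only [map_mul, gAct_X, MvPolynomial.algHom_C, MvPolynomial.algebraMap_eq, Matrix.mul_apply,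
    map_sum, Finset.mul_sum, Finset.sum_mul]
  rw [Finset.sum_comm]
  refine Finset.sum_congr rfl fun i _ => Finset.sum_congr rfl fun k _ => ?_
  ring

lemma gAct_one : gAct F n 1 = AlgHom.id F _ := by
  refine MvPolynomial.algHom_ext fun j => ?_
  rw [gAct_X, Finset.sum_eq_single j] <;> simp +contextual

end Actions

/-! ### The parabolic subgroup -/

section Parabolic

variable {F : Type} [Field F] {n : ℕ} (I : Composition n)

lemma blkIdx_mono {a b : ℕ} (h : a ≤ b) : blkIdx n I a ≤ blkIdx n I b :=
  Finset.card_le_card (Finset.monotone_filter_right _ fun _ _ hi => hi.trans h)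

lemma le_blkIdx {a k : ℕ} (ha : a < n) (hk : I.sizeUpTo k ≤ a) : k ≤ blkIdx n I a := by
  have hkl : k ≤ I.length := by
    by_contra! h
    rw [I.sizeUpTo_ofLength_le k h.le] at hk
    omega
  conv_lhs => rw [← Finset.card_range k]
  refine Finset.card_le_card fun i hi => ?_
  have hi := mem_range.1 hi
  exact mem_filter.2 ⟨mem_range.2 (hi.trans_le hkl), (I.monotone_sizeUpTo hi).trans hk⟩

lemma blkIdx_lt {a k : ℕ} (hk : a < I.sizeUpTo k) : blkIdx n I a < k := by
  have hk0 : k ≠ 0 := by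
    rintro rfl
    rw [I.sizeUpTo_zero] at hk
    omega
  refine lt_of_le_of_lt (b := k - 1) ?_ (by omega)
  conv_rhs => rw [← Finset.card_range (k - 1)]
  refine Finset.card_le_card fun i hi => mem_range.2 ?_
  by_contra! h
  have := I.monotone_sizeUpTo (show k ≤ i + 1 by omega)
  have := (mem_filter.1 hi).2
  omega

variable {I}

lemma entry_eq_zero {g : Matrix (Fin n) (Fin n) F} (hg : g ∈ PIset F n I) {s t k : ℕ}
    (ht : t < I.sizeUpTo k) (hs : I.sizeUpTo k ≤ s) : entry g s t = 0 := by
  rw [entry]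
  split_ifs with h
  · exact hg.2 _ _ ((blkIdx_lt I ht).trans_le (le_blkIdx I h.1 hs))
  · rfl

lemma inv_mem_PIset {g : Matrix (Fin n) (Fin n) F} (hg : g ∈ PIset F n I) :
    g⁻¹ ∈ PIset F n I := by
  let := g.invertibleOfIsUnitDet hg.1
  exact ⟨g.isUnit_nonsing_inv_det hg.1,
    Matrix.blockTriangular_inv_of_blockTriangular (b := fun a : Fin n => blkIdx n I a) hg.2⟩

lemma gAct_xV_of_mem {g : Matrix (Fin n) (Fin n) F} (hg : g ∈ PIset F n I) {k t : ℕ}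
    (ht : t < I.sizeUpTo k) : gAct F n g (xV F n t) =
      ∑ s ∈ range (I.sizeUpTo k), algebraMap F (SV F n) (entry g s t) * xV F n s := by
  rw [gAct_xV g (ht.trans_le (I.sizeUpTo_le k))]
  symm
  refine Finset.sum_subset (Finset.range_subset_range.2 (I.sizeUpTo_le k)) fun s _ hs => ?_
  rw [entry_eq_zero hg ht (by simpa using hs), map_zero, zero_mul]

lemma exists_xV_eq_sum {g : Matrix (Fin n) (Fin n) F} (hg : g ∈ PIset F n I) {k t : ℕ}
    (ht : t < I.sizeUpTo k) : ∃ a : ℕ → F, xV F n t =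
      ∑ s ∈ range (I.sizeUpTo k), algebraMap F (SV F n) (a s) * gAct F n g (xV F n s) := by
  refine ⟨fun s => entry g⁻¹ s t, ?_⟩
  have h := congrArg (gAct F n g) (gAct_xV_of_mem (inv_mem_PIset hg) ht)
  rw [gAct_gAct, Matrix.mul_nonsing_inv _ hg.1, gAct_one, map_sum] at h
  rw [show xV F n t = AlgHom.id F _ (xV F n t) from rfl, h]
  refine Finset.sum_congr rfl fun s _ => ?_
  rw [map_mul, AlgHom.commutes]

lemma mem_PIset_of_upper {g : Matrix (Fin n) (Fin n) F} (hg : g.BlockTriangular id)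
    (hd : ∀ a, g a a ≠ 0) : g ∈ PIset F n I := by
  refine ⟨?_, fun a b hab => hg (lt_of_not_ge fun h => ?_)⟩
  · rw [Matrix.det_of_isUpperTriangular hg, isUnit_iff_ne_zero]
    exact Finset.prod_ne_zero_iff.2 fun a _ => hd a
  · exact absurd (blkIdx_mono I (show (a : ℕ) ≤ b from h)) (not_le.2 hab)

lemma transvection_mem_PIset {s t : Fin n} (hst : s ≠ t) (a : F) {k : ℕ}
    (hs : (s : ℕ) < I.sizeUpTo (k + 1)) (ht : I.sizeUpTo k ≤ t) :
    Matrix.transvection s t a ∈ PIset F n I := by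
  refine ⟨by rw [Matrix.det_transvection_of_ne s t hst]; exact isUnit_one, fun c d hcd => ?_⟩
  have hne : c ≠ d := by
    rintro rfl
    exact lt_irrefl _ hcd
  rw [Matrix.transvection, Matrix.add_apply, Matrix.one_apply_ne hne, zero_add,
    Matrix.single_apply, if_neg]
  rintro ⟨rfl, rfl⟩
  have h1 := blkIdx_lt I hs
  have h2 := le_blkIdx I t.2 ht
  omega

lemma exists_gAct_eq_shift (I : Composition n) (s : ℕ) (c : Fin s → F) :
    ∃ g ∈ PIset F n I, gAct F n g = shift n s c := by
  let g : Matrix (Fin n) (Fin n) F := Matrix.of fun i j =>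
    if i = j then 1 else if h : (j : ℕ) = s ∧ (i : ℕ) < s then c ⟨i, h.2⟩ else 0
  have hg : ∀ i j, g i j = if i = j then 1 else if h : (j : ℕ) = s ∧ (i : ℕ) < s then c ⟨i, h.2⟩ else 0 :=
    fun i j => rfl
  refine ⟨g, mem_PIset_of_upper (fun i j hij => ?_) (fun a => ?_), MvPolynomial.algHom_ext fun j => ?_⟩
  · rw [hg, if_neg (show j < i from hij).ne', dif_neg]
    rintro ⟨h1, h2⟩
    have : (j : ℕ) < i := hij
    omega
  · rw [hg, if_pos rfl]
    exact one_ne_zero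
  · rw [gAct_X, ← xV_of_lt j.2]
    by_cases hj : (j : ℕ) = s
    · rw [hj, shift_xV (hj ▸ j.2), linForm]
      have h1 : ∀ i : Fin n, MvPolynomial.C (g i j) * X i =
          (if h : (i : ℕ) < s then MvPolynomial.C (c ⟨i, h⟩) * xV F n i else 0) +
            if i = j then X i else 0 := by
        intro i
        rw [hg]
        by_cases hij : i = j
        · subst hij
          simp [hj]
        · simp only [if_neg hij, hj, true_and, add_zero, xV_of_lt i.2]
          split_ifs <;> simp
      simp only [h1, Finset.sum_add_distrib, Finset.sum_ite_eq', mem_univ, if_true]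
      have h2 := Fin.sum_univ_eq_sum_range (fun i : ℕ =>
        if h : i < s then MvPolynomial.C (c ⟨i, h⟩) * xV F n i else 0) n
      have h3 := Fin.sum_univ_eq_sum_range (fun i : ℕ =>
        if h : i < s then MvPolynomial.C (c ⟨i, h⟩) * xV F n i else 0) s
      simp only [Fin.is_lt, dif_pos, Fin.eta] at h3
      have hX : X j = xV F n s := by rw [← hj, xV_of_lt j.2]
      rw [h2, h3, hX]
      congr 1
      symm
      refine Finset.sum_subset (Finset.range_subset_range.2 (hj ▸ j.2.le)) fun i _ hi => ?_
      rw [dif_neg (by simpa using hi)]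
    · rw [shift_xV_of_ne _ hj, xV_of_lt j.2, Finset.sum_eq_single j]
      · simp [hg]
      · intro i _ hij
        rw [hg, if_neg hij, dif_neg (fun h => hj h.1), map_zero, zero_mul]
      · simp

lemma exists_gAct_eq_dilate (I : Composition n) (s : ℕ) {a : F} (ha : a ≠ 0) :
    ∃ g ∈ PIset F n I, gAct F n g = dilate n s a := by
  refine ⟨Matrix.diagonal fun j : Fin n => if (j : ℕ) = s then a else 1,
    mem_PIset_of_upper (Matrix.blockTriangular_diagonal _) (fun j => ?_),
    MvPolynomial.algHom_ext fun j => ?_⟩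
  · rw [Matrix.diagonal_apply_eq]
    split_ifs
    exacts [ha, one_ne_zero]
  · rw [gAct_X, dilate, aeval_X, Finset.sum_eq_single j]
    · rw [Matrix.diagonal_apply_eq]
      split_ifs <;> simp
    · intro i _ hij
      rw [Matrix.diagonal_apply_ne _ hij, map_zero, zero_mul]
    · simp

lemma dvd_sub_gAct_transvection {s t : Fin n} (a : F) (p : SV F n) :
    X s ∣ p - gAct F n (Matrix.transvection s t a) p := by
  rw [← Ideal.mem_span_singleton, ← Ideal.Quotient.eq]
  have : (Ideal.Quotient.mkₐ F (Ideal.span {(X s : SV F n)})).comp (AlgHom.id F _) =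
      (Ideal.Quotient.mkₐ F (Ideal.span {(X s : SV F n)})).comp
        (gAct F n (Matrix.transvection s t a)) := by
    refine MvPolynomial.algHom_ext fun j => ?_
    rw [AlgHom.comp_apply, AlgHom.comp_apply, gAct_X]
    refine Ideal.Quotient.eq.2 (Ideal.mem_span_singleton.2 ?_)
    have h1 : ∀ i, MvPolynomial.C (Matrix.transvection s t a i j) * (X i : SV F n) =
        (if i = j then X i else 0) + if i = s then MvPolynomial.C (if t = j then a else 0) * X i else 0 := by
      intro i
      rw [Matrix.transvection, Matrix.add_apply, Matrix.one_apply, Matrix.single_apply, map_add,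
        add_mul]
      congr 1
      · split_ifs <;> simp
      · rcases eq_or_ne i s with rfl | h
        · simp
        · simp [h, h.symm]
    simp only [h1, Finset.sum_add_distrib, Finset.sum_ite_eq', mem_univ, if_true]
    rw [AlgHom.id_apply, sub_add_cancel_left, dvd_neg]
    exact dvd_mul_left _ _
  exact DFunLike.congr_fun this p

lemma fixedByTransvection {f : SL F n} (hf : f ∈ invSL F n (PIset F n I)) {s t k : ℕ}
    (hs : s < I.sizeUpTo (k + 1)) (ht : t < n) (hkt : I.sizeUpTo k ≤ t) (hst : s ≠ t) :
    (slExt F n).FixedByTransvection (xV F n s) s t f := by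
  have hsn := hs.trans_le (I.sizeUpTo_le (k + 1))
  have hst' : (⟨s, hsn⟩ : Fin n) ≠ ⟨t, ht⟩ := fun h => hst (congrArg Fin.val h)
  have hentry : ∀ a < n, ∀ b < n, entry (Matrix.transvection (⟨s, hsn⟩ : Fin n) ⟨t, ht⟩ (1 : F)) a b =
      (if a = b then 1 else 0) + if a = s ∧ b = t then 1 else 0 := by
    intro a ha b hb
    rw [entry_of_lt _ ha hb, Matrix.transvection, Matrix.add_apply, Matrix.one_apply,
      Matrix.single_apply]
    simp only [Fin.mk.injEq, eq_comm]
  refine ⟨(gAct F n (Matrix.transvection ⟨s, hsn⟩ ⟨t, ht⟩ 1) : SV F n →+* SV F n),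
    (tAct F n (Matrix.transvection ⟨s, hsn⟩ ⟨t, ht⟩ 1) : SL F n →+* SL F n), fun p => ?_,
    tAct_smul _, ?_, fun c hc hct => ?_, hf _ (transvection_mem_PIset hst' 1 hs hkt)⟩
  · rw [xV_of_lt hsn]
    exact dvd_sub_gAct_transvection 1 p
  · refine (tAct_y _ ht).trans ?_
    rw [← Finset.add_sum_erase _ _ (mem_range.2 ht),
      Finset.sum_eq_single_of_mem s (mem_erase.2 ⟨hst, mem_range.2 hsn⟩) ?_,
      hentry t ht t ht, hentry s hsn t ht]
    · simp [hst, hst.symm]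
    · intro b hb hbs
      rw [hentry b (mem_range.1 (mem_erase.1 hb).2) t ht, if_neg (mem_erase.1 hb).1,
        if_neg fun h => hbs h.1, add_zero, map_zero, zero_smul]
  · refine (tAct_y _ hc).trans ?_
    rw [Finset.sum_eq_single_of_mem c (mem_range.2 hc) ?_, hentry c hc c hc]
    · simp [hct]
    · intro b hb hbc
      rw [hentry b (mem_range.1 hb) c hc, if_neg hbc, if_neg fun h => hct h.2, add_zero, map_zero,
        zero_smul]

end Parabolic

/-! ### Moore determinants of the variables -/

section Variables

variable (F : Type) [Field F] [Fintype F] (n : ℕ)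

/-- The Moore determinant of `x 0, …, x (m - 1)` as a product. -/
def moore (m : ℕ) : SV F n := ∏ a ∈ range m, linPoly F (xV F n) a (xV F n a)

variable {n} in
lemma linPoly_xV (a t : ℕ) : linPoly F (xV F n) a (xV F n t) = linProd F n a t :=
  linPoly_eq_prod _ _ _

lemma moore_eq_prod_linForm (m : ℕ) :
    moore F n m = ∏ s ∈ range m, ∏ c : Fin s → F, linForm F n s c :=
  Finset.prod_congr rfl fun s _ => linPoly_xV F s s

lemma moore_ne_zero {m : ℕ} (hm : m ≤ n) : moore F n m ≠ 0 := by
  rw [moore_eq_prod_linForm]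
  exact Finset.prod_ne_zero_iff.2 fun s hs => Finset.prod_ne_zero_iff.2 fun c _ =>
    (irreducible_linForm ((mem_range.1 hs).trans_le hm) c).ne_zero

lemma regular_xV : ExtBasis.Regular F (xV F n) n := by
  intro m hm
  rw [minor_pow_eq_prod]
  exact moore_ne_zero F n hm

variable {n} (I : Composition n)

lemma theta_eq_prod (i : Fin I.length) :
    theta F n I i = ∏ a ∈ range (I.blocksFun i),
      linPoly F (xV F n) (I.sizeUpTo i + a) (xV F n (I.sizeUpTo i + a)) := by
  rw [theta, Lm, map_prod]
  refine Finset.prod_congr rfl fun a ha => ?_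
  have ha := mem_range.1 ha
  have hv : ∀ k < I.blocksFun i, (MvPolynomial.aeval (R := F)
      (fun t : Fin (I.blocksFun i) => vij F n I i t)) (xV F (I.blocksFun i) k) =
        linPoly F (xV F n) (I.sizeUpTo i) (xV F n (I.sizeUpTo i + k)) := by
    intro k hk
    rw [xV_of_lt hk, aeval_X, vij, linPoly_xV]
  rw [← linPoly_comp, linPoly_eq_prod, linProd, map_prod]
  refine Finset.prod_congr rfl fun c _ => ?_
  rw [map_add, map_sum, hv a ha]
  congr 1
  refine Finset.sum_congr rfl fun k _ => ?_
  rw [map_mul, hv k (k.2.trans ha), MvPolynomial.algHom_C]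

lemma moore_sizeUpTo_succ (i : Fin I.length) :
    moore F n (I.sizeUpTo (i + 1)) = theta F n I i * moore F n (I.sizeUpTo i) := by
  rw [theta_eq_prod, moore, moore, I.sizeUpTo_succ' i, Finset.prod_range_add, mul_comm]

lemma prod_theta (k : ℕ) (hk : k ≤ I.length) :
    ∏ i : Fin I.length, (if (i : ℕ) < k then theta F n I i else 1) = moore F n (I.sizeUpTo k) := by
  induction k with
  | zero => simp [moore]
  | succ k ih =>
    rw [moore_sizeUpTo_succ F I ⟨k, hk⟩, ← ih (by omega),
      ← Finset.mul_prod_erase _ _ (mem_univ (⟨k, hk⟩ : Fin I.length)),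
      ← Finset.mul_prod_erase univ (fun i : Fin I.length => if (i : ℕ) < k then _ else _)
        (mem_univ (⟨k, hk⟩ : Fin I.length)), if_pos (Nat.lt_succ_self k), if_neg (lt_irrefl k),
      one_mul]
    congr 1
    refine Finset.prod_congr rfl fun i hi => ?_
    have hik : (i : ℕ) ≠ k := fun h => (mem_erase.1 hi).1 (Fin.ext h)
    exact if_congr (by omega) rfl rfl

lemma prod_theta_pow (j : Fin I.length) (d : ℕ) :
    ∏ i : Fin I.length, theta F n I i ^ (if i ≤ j then d else 0) =
      moore F n (I.sizeUpTo (j + 1)) ^ d := by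
  rw [← prod_theta F I (j + 1) j.2, ← Finset.prod_pow]
  refine Finset.prod_congr rfl fun i _ => ?_
  have : i ≤ j ↔ (i : ℕ) < j + 1 := by rw [Nat.lt_succ_iff]; rfl
  by_cases h : i ≤ j
  · rw [if_pos h, if_pos (this.1 h)]
  · rw [if_neg h, if_neg (fun h' => h (this.2 h')), pow_zero, one_pow]

lemma MuiM_eq_mui (m : ℕ) (B : Finset ℕ) :
    MuiM F (Fintype.card F) n m B = (slExt F n).mui F (xV F n) m B := by
  refine Finset.sum_congr rfl fun T _ => ?_
  have h : ∀ (p : SV F n) (y : LV F n), p • ((1 : SV F n) ⊗ₜ[F] y) = p ⊗ₜ[F] y := by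
    intro p y
    rw [TensorProduct.smul_tmul', smul_eq_mul, mul_one]
  rw [slExt_e, h, ← algebraMap_smul (SV F n) ((-1 : F) ^ _), map_pow, map_neg, map_one]
  rfl

variable {F I}

lemma gAct_moore_pow {g : Matrix (Fin n) (Fin n) F} (hg : g ∈ PIset F n I) (k : ℕ) :
    gAct F n g (moore F n (I.sizeUpTo k) ^ (Fintype.card F - 1)) =
      moore F n (I.sizeUpTo k) ^ (Fintype.card F - 1) :=
  ExtBasis.map_prod_linPoly_pow (fun _ ht => exists_xV_eq_sum hg ht) (moore_ne_zero F n (I.sizeUpTo_le k))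

/-- The basis element attached to an admissible index. -/
lemma frob_generator (j : Fin I.length) {B : Finset ℕ} (hB : B ⊆ range (I.sizeUpTo (j + 1))) :
    ∃ ε : SV F n, (ε = 1 ∨ ε = -1) ∧ ∀ c : SV F n,
      (slExt_hasLift F n).frob F (xV F n) ((c ⊗ₜ[F] 1) *
        (MuiM F (Fintype.card F) n (I.sizeUpTo (j + 1)) B *
          ((∏ i : Fin I.length, theta F n I i ^ (if i ≤ j then Fintype.card F - 2 else 0)) ⊗ₜ[F] 1))) =
      (c * ε * moore F n (I.sizeUpTo (j + 1)) ^ (Fintype.card F - 1)) •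
        (slExt_hasLift F n).tower F (xV F n) (I.sizeUpTo (j + 1)) ((slExt F n).e B) := by
  obtain ⟨ε, hε, h⟩ := (slExt_hasLift F n).frob_mui (F := F) (xV F n) (I.sizeUpTo_le (j + 1)) hB
  refine ⟨ε, hε, fun c => ?_⟩
  have hsmul : ∀ (p : SV F n) (f : SL F n), (p ⊗ₜ[F] 1) * f = p • f := fun p f =>
    (Algebra.smul_def p f).symm
  have hcomm : ∀ (p : SV F n) (f : SL F n), f * (p ⊗ₜ[F] 1) = p • f := fun p f =>
    ((Algebra.commutes p f).symm).trans (Algebra.smul_def p f).symm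
  rw [hsmul, hcomm, prod_theta_pow, map_smul, map_smul, MuiM_eq_mui, h, smul_smul, smul_smul]
  congr 1
  have hq : Fintype.card F - 1 = Fintype.card F - 2 + 1 := by
    have := Fintype.one_lt_card (α := F)
    omega
  rw [hq, pow_succ]
  unfold moore
  ring

end Variables

/-! ### Invariants of the parabolic subgroup -/

section Invariants

variable {F : Type} [Field F] [Fintype F] {n : ℕ} {I : Composition n}

lemma length_mem_range_sizeUpTo (I : Composition n) : n ∈ Set.range I.sizeUpTo :=
  ⟨I.length, I.sizeUpTo_length⟩

/-- The linear isomorphism comparing the monomials with the products of Mui type. -/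
abbrev muiTheta (F : Type) [Field F] [Fintype F] (I : Composition n) : SL F n →ₗ[SV F n] SL F n :=
  (slExt F n).theta (Set.range I.sizeUpTo) ((slExt_hasLift F n).tower F (xV F n))

lemma muiTheta_bijective : Function.Bijective (muiTheta F I) :=
  ((slExt_hasLift F n).isTower (regular_xV F n)).theta_bijective (length_mem_range_sizeUpTo I)

lemma frob_injective :
    Function.Injective ((slExt_hasLift F n).frob F (xV F n)) :=
  (slExt_hasLift F n).frob_injective (regular_xV F n)

lemma coeffAct_muiTheta {g : Matrix (Fin n) (Fin n) F} (hg : g ∈ PIset F n I) (f : SL F n) :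
    coeffAct g (muiTheta F I f) = muiTheta F I (coeffAct g f) := by
  refine (slExt_hasLift F n).map_theta (regular_xV F n) (actsOnCoeffs g)
    (length_mem_range_sizeUpTo I) ?_ f
  rintro _ ⟨k, rfl⟩ t ht
  exact exists_xV_eq_sum hg ht

lemma frob_tAct (g : Matrix (Fin n) (Fin n) F) (f : SL F n) :
    (slExt_hasLift F n).frob F (xV F n) (tAct F n g f) =
      coeffAct g ((slExt_hasLift F n).frob F (xV F n) f) :=
  (slExt_hasLift F n).frob_comm (actsOnCoeffs g) (τ := (tAct F n g : SL F n →+* SL F n))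
    (tAct_smul g) (g := entry g) (fun _ ht => tAct_y g ht) (fun _ ht => gAct_xV g ht) f

lemma mem_invSL_iff {f h : SL F n}
    (hh : muiTheta F I h = (slExt_hasLift F n).frob F (xV F n) f) :
    f ∈ invSL F n (PIset F n I) ↔
      ∀ B ⊆ range n, (slExt F n).cf B h ∈ invS F n (PIset F n I) := by
  have key : ∀ g ∈ PIset F n I, tAct F n g f = f ↔
      ∀ B ⊆ range n, gAct F n g ((slExt F n).cf B h) = (slExt F n).cf B h := by
    intro g hg
    rw [← frob_injective.eq_iff, frob_tAct, ← hh, coeffAct_muiTheta hg,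
      muiTheta_bijective.1.eq_iff]
    exact (actsOnCoeffs g).map_eq_self_iff h
  exact ⟨fun hf B hB g hg => (key g hg).1 (hf g hg) B hB,
    fun hf g hg => (key g hg).2 fun B hB => hf B hB g hg⟩

lemma moore_pow_dvd_cf {f h : SL F n} (hf : f ∈ invSL F n (PIset F n I))
    (hh : muiTheta F I h = (slExt_hasLift F n).frob F (xV F n) f) {B : Finset ℕ}
    (hB : B ⊆ range n) {k : ℕ} (hk : ¬ B ⊆ range (I.sizeUpTo k)) :
    moore F n (I.sizeUpTo (k + 1)) ^ (Fintype.card F - 1) ∣ (slExt F n).cf B h := by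
  have hinv := (mem_invSL_iff hh).1 hf B hB
  rw [moore_eq_prod_linForm]
  refine prod_linForm_pow_dvd (I.sizeUpTo_le _) (fun s hs => ?_) (fun s _ a ha => ?_) fun s _ c => ?_
  · have hsn := hs.trans_le (I.sizeUpTo_le (k + 1))
    have h1 : I.sizeUpTo (I.index ⟨s, hsn⟩) ≤ s := I.sizeUpTo_index_le ⟨s, hsn⟩
    have h2 : s < I.sizeUpTo (I.index ⟨s, hsn⟩ + 1) := I.lt_sizeUpTo_index_succ ⟨s, hsn⟩
    refine (slExt_hasLift F n).dvd_cf (regular_xV F n) (length_mem_range_sizeUpTo I)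
      ⟨(I.index ⟨s, hsn⟩ : ℕ), rfl⟩ (I.sizeUpTo_le _) hsn hh
      (fun t ht hmt hst => fixedByTransvection hf h2 ht hmt hst) hB fun hsub => hk ?_
    refine hsub.trans (Finset.range_subset_range.2 (I.monotone_sizeUpTo ?_))
    by_contra! hlt
    have := I.monotone_sizeUpTo (show k + 1 ≤ I.index ⟨s, hsn⟩ from hlt)
    omega
  · obtain ⟨g, hg, hg'⟩ := exists_gAct_eq_dilate I s ha
    rw [← hg', hinv g hg]
  · obtain ⟨g, hg, hg'⟩ := exists_gAct_eq_shift I s c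
    rw [← hg', hinv g hg]

lemma mem_invS_of_mul_moore_pow {k : ℕ} {w : SV F n}
    (hw : w * moore F n (I.sizeUpTo k) ^ (Fintype.card F - 1) ∈ invS F n (PIset F n I)) :
    w ∈ invS F n (PIset F n I) := by
  intro g hg
  have h := hw g hg
  rw [map_mul, gAct_moore_pow hg] at h
  exact mul_right_cancel₀ (pow_ne_zero _ (moore_ne_zero F n (I.sizeUpTo_le k))) h

lemma moore_pow_mem_invS (k : ℕ) :
    moore F n (I.sizeUpTo k) ^ (Fintype.card F - 1) ∈ invS F n (PIset F n I) :=
  fun _ hg => gAct_moore_pow hg k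

end Invariants

/-! ### Admissible indices -/

section Admissible

variable {n : ℕ} {I : Composition n}

lemma mem_Adm {x : Fin I.length × Finset ℕ} : x ∈ Adm n I ↔
    x.2 ⊆ range (I.sizeUpTo (x.1 + 1)) ∧ ¬ x.2 ⊆ range (I.sizeUpTo x.1) := by
  simp only [Adm, mem_filter, mem_product, mem_univ, true_and, mem_powerset, Finset.not_subset,
    mem_range, not_lt]
  refine ⟨fun h => ⟨h.2.1, h.2.2.2⟩, fun h => ⟨h.1.trans ?_, h.1, ?_, h.2⟩⟩
  · exact Finset.range_subset_range.2 (I.sizeUpTo_le _)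
  · exact h.2.imp fun _ hb => hb.1

lemma subset_range_of_mem_Adm {x : Fin I.length × Finset ℕ} (hx : x ∈ Adm n I) :
    x.2 ⊆ range n :=
  (mem_Adm.1 hx).1.trans (Finset.range_subset_range.2 (I.sizeUpTo_le _))

lemma nonempty_of_mem_Adm {x : Fin I.length × Finset ℕ} (hx : x ∈ Adm n I) : x.2.Nonempty := by
  obtain ⟨b, hb, -⟩ := Finset.not_subset.1 (mem_Adm.1 hx).2
  exact ⟨b, hb⟩

lemma Adm_injOn : Set.InjOn Prod.snd (Adm n I : Set (Fin I.length × Finset ℕ)) := by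
  have key : ∀ x ∈ Adm n I, ∀ y ∈ Adm n I, x.2 = y.2 → ¬ x.1 < y.1 := by
    intro x hx y hy h hlt
    refine (mem_Adm.1 hy).2 (h ▸ (mem_Adm.1 hx).1.trans ?_)
    exact Finset.range_subset_range.2 (I.monotone_sizeUpTo (Nat.succ_le_of_lt hlt))
  intro x hx y hy h
  exact Prod.ext (le_antisymm (not_lt.1 (key y hy x hx h.symm)) (not_lt.1 (key x hx y hy h))) h

lemma image_Adm : (Adm n I).image Prod.snd = (range n).powerset.erase ∅ := by
  ext B
  simp only [mem_image, mem_erase, mem_powerset]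
  constructor
  · rintro ⟨x, hx, rfl⟩
    exact ⟨(nonempty_of_mem_Adm hx).ne_empty, subset_range_of_mem_Adm hx⟩
  · rintro ⟨hne, hB⟩
    have hne := Finset.nonempty_iff_ne_empty.2 hne
    have hmax := mem_range.1 (hB (B.max'_mem hne))
    refine ⟨(I.index ⟨B.max' hne, hmax⟩, B), mem_Adm.2 ⟨fun b hb => mem_range.2 ?_, fun h => ?_⟩, rfl⟩
    · exact (B.le_max' b hb).trans_lt (I.lt_sizeUpTo_index_succ ⟨B.max' hne, hmax⟩)
    · exact absurd (mem_range.1 (h (B.max'_mem hne)))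
        (not_lt.2 (I.sizeUpTo_index_le ⟨B.max' hne, hmax⟩))

lemma card_Adm : 1 + (Adm n I).card = 2 ^ n := by
  rw [← Finset.card_image_of_injOn Adm_injOn, image_Adm, Finset.card_erase_of_mem (by simp),
    Finset.card_powerset, Finset.card_range]
  have := Nat.one_le_two_pow (n := n)
  omega

lemma lev_of_mem_Adm {x : Fin I.length × Finset ℕ} (hx : x ∈ Adm n I) :
    ExtBasis.lev (Set.range I.sizeUpTo) x.2 = I.sizeUpTo (x.1 + 1) := by
  obtain ⟨h1, h2⟩ := mem_Adm.1 hx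
  refine le_antisymm (ExtBasis.lev_le ⟨_, rfl⟩ h1) ?_
  obtain ⟨⟨k, hk⟩, h3⟩ := ExtBasis.lev_spec (M := Set.range I.sizeUpTo) ⟨_, rfl⟩ h1
  rw [← hk] at h3 ⊢
  refine I.monotone_sizeUpTo ?_
  by_contra! hlt
  exact h2 (h3.trans (Finset.range_subset_range.2 (I.monotone_sizeUpTo (by omega))))

/-- A sum over the admissible indices as a sum over all sets of exponents. -/
lemma exists_sum_powerset {A N : Type*} [AddCommMonoid N] [Zero A] (a₀ : A)
    (a : Fin I.length × Finset ℕ → A) : ∃ α : Finset ℕ → A, α ∅ = a₀ ∧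
      (∀ x ∈ Adm n I, α x.2 = a x) ∧ ∀ v : A → Finset ℕ → N,
        ∑ B ∈ (range n).powerset, v (α B) B = v a₀ ∅ + ∑ x ∈ Adm n I, v (a x) x.2 := by
  classical
  let α : Finset ℕ → A := fun B => if B = ∅ then a₀ else
    if h : ∃ x ∈ Adm n I, x.2 = B then a h.choose else 0
  have hα : ∀ x ∈ Adm n I, α x.2 = a x := by
    intro x hx
    have h : ∃ y ∈ Adm n I, y.2 = x.2 := ⟨x, hx, rfl⟩
    simp only [α]
    rw [if_neg (nonempty_of_mem_Adm hx).ne_empty, dif_pos h]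
    exact congrArg a (Adm_injOn h.choose_spec.1 hx h.choose_spec.2)
  refine ⟨α, if_pos rfl, hα, fun v => ?_⟩
  rw [← Finset.add_sum_erase _ _ (Finset.empty_mem_powerset _), ← image_Adm,
    Finset.sum_image Adm_injOn, show α ∅ = a₀ from if_pos rfl]
  exact congrArg _ (Finset.sum_congr rfl fun x hx => by rw [hα x hx])

end Admissible

/-! ### The basis theorem -/

section Basis

variable {F : Type} [Field F] [Fintype F] {n : ℕ} {I : Composition n}

/-- The element of `S(V) ⊗ Λ(V)` attached to an admissible index. -/
abbrev muiGen (F : Type) [Field F] [Fintype F] (I : Composition n)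
    (x : Fin I.length × Finset ℕ) : SL F n :=
  MuiM F (Fintype.card F) n (I.sizeUpTo ((x.1 : ℕ) + 1)) x.2 *
    ((∏ i : Fin I.length, theta F n I i ^ (if i ≤ x.1 then Fintype.card F - 2 else 0)) ⊗ₜ[F] 1)

variable (F I) in
/-- The signs relating the images of the elements of Mui type to the monomials. -/
lemma exists_signs : ∃ ε : Fin I.length × Finset ℕ → SV F n,
    (∀ x ∈ Adm n I, ε x = 1 ∨ ε x = -1) ∧ ∀ c₀ : SV F n, ∀ c : Fin I.length × Finset ℕ → SV F n,
      ∃ h : SL F n, muiTheta F I h = (slExt_hasLift F n).frob F (xV F n)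
          (c₀ ⊗ₜ[F] 1 + ∑ x ∈ Adm n I, (c x ⊗ₜ[F] 1) * muiGen F I x) ∧
        (slExt F n).cf ∅ h = c₀ ∧ ∀ x ∈ Adm n I, (slExt F n).cf x.2 h =
          c x * ε x * moore F n (I.sizeUpTo (x.1 + 1)) ^ (Fintype.card F - 1) := by
  have hgen := fun (x : Fin I.length × Finset ℕ) (hx : x ∈ Adm n I) =>
    frob_generator (F := F) x.1 (mem_Adm.1 hx).1
  choose! ε hε h using hgen
  refine ⟨ε, hε, fun c₀ c => ?_⟩
  obtain ⟨α, hα₀, hα, hsum⟩ := exists_sum_powerset (N := SL F n) (I := I) c₀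
    fun x => c x * ε x * moore F n (I.sizeUpTo (x.1 + 1)) ^ (Fintype.card F - 1)
  refine ⟨∑ B ∈ (range n).powerset, α B • (slExt F n).e B, ?_, ?_, fun x hx => ?_⟩
  · have h1 : muiTheta F I (∑ B ∈ (range n).powerset, α B • (slExt F n).e B) =
        ∑ B ∈ (range n).powerset, α B • (slExt_hasLift F n).tower F (xV F n)
          (ExtBasis.lev (Set.range I.sizeUpTo) B) ((slExt F n).e B) := by
      rw [map_sum]
      refine Finset.sum_congr rfl fun B hB => ?_
      rw [map_smul, muiTheta, ExtBasis.theta_e _ _ _ (mem_powerset.1 hB)]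
    have h2 : c₀ ⊗ₜ[F] (1 : LV F n) = c₀ • (1 : SL F n) := Algebra.algebraMap_eq_smul_one (A := SL F n) c₀
    rw [h1, hsum fun a B => a • (slExt_hasLift F n).tower F (xV F n)
          (ExtBasis.lev (Set.range I.sizeUpTo) B) ((slExt F n).e B),
      map_add, map_sum, ExtBasis.e_empty, map_one, h2, map_smul, map_one]
    congr 1
    refine Finset.sum_congr rfl fun x hx => ?_
    rw [h x hx, lev_of_mem_Adm hx]
  · rw [(slExt F n).cf_sum (Finset.empty_subset _), hα₀]
  · rw [(slExt F n).cf_sum (subset_range_of_mem_Adm hx), hα x hx]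

lemma forall_subset_range_of_Adm {P : Finset ℕ → Prop} (h₀ : P ∅) (h : ∀ x ∈ Adm n I, P x.2)
    {B : Finset ℕ} (hB : B ⊆ range n) : P B := by
  rcases eq_or_ne B ∅ with rfl | hne
  · exact h₀
  · have hB' : B ∈ (Adm n I).image Prod.snd := by
      rw [image_Adm]
      exact mem_erase.2 ⟨hne, mem_powerset.2 hB⟩
    obtain ⟨x, hx, rfl⟩ := mem_image.1 hB'
    exact h x hx

lemma mem_invSL_iff_exists (f : SL F n) : f ∈ invSL F n (PIset F n I) ↔
    ∃ c₀ : SV F n, ∃ c : Fin I.length × Finset ℕ → SV F n,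
      c₀ ∈ invS F n (PIset F n I) ∧ (∀ x ∈ Adm n I, c x ∈ invS F n (PIset F n I)) ∧
      f = c₀ ⊗ₜ[F] 1 + ∑ x ∈ Adm n I, (c x ⊗ₜ[F] 1) * muiGen F I x := by
  obtain ⟨ε, hε, hexp⟩ := exists_signs F I
  have hεinv : ∀ x ∈ Adm n I, ε x ∈ invS F n (PIset F n I) := by
    intro x hx
    rcases hε x hx with h | h <;> rw [h]
    exacts [one_mem _, neg_mem (one_mem _)]
  have hεsq : ∀ x ∈ Adm n I, ε x * ε x = 1 := by
    intro x hx
    rcases hε x hx with h | h <;> rw [h] <;> ring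
  constructor
  · intro hf
    obtain ⟨h, hh⟩ := (muiTheta_bijective (F := F) (I := I)).2
      ((slExt_hasLift F n).frob F (xV F n) f)
    have hinv := (mem_invSL_iff hh).1 hf
    have hdvd : ∀ x ∈ Adm n I, ∃ w, (slExt F n).cf x.2 h =
        w * moore F n (I.sizeUpTo (x.1 + 1)) ^ (Fintype.card F - 1) := by
      intro x hx
      obtain ⟨w, hw⟩ := moore_pow_dvd_cf hf hh (subset_range_of_mem_Adm hx) (mem_Adm.1 hx).2
      exact ⟨w, hw.trans (mul_comm _ _)⟩
    choose! w hw using hdvd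
    refine ⟨(slExt F n).cf ∅ h, fun x => w x * ε x, hinv _ (Finset.empty_subset _),
      fun x hx => mul_mem (mem_invS_of_mul_moore_pow (k := x.1 + 1) ?_) (hεinv x hx), ?_⟩
    · rw [← hw x hx]
      exact hinv _ (subset_range_of_mem_Adm hx)
    · obtain ⟨h', hh', h₀, hc⟩ := hexp ((slExt F n).cf ∅ h) fun x => w x * ε x
      refine frob_injective ?_
      rw [← hh', ← hh]
      congr 1
      refine (slExt F n).ext_cf fun B hB => ?_
      refine forall_subset_range_of_Adm (I := I)
        (P := fun B => (slExt F n).cf B h = (slExt F n).cf B h') h₀.symm (fun x hx => ?_) hB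
      rw [hc x hx, hw x hx, mul_assoc (w x), hεsq x hx, mul_one]
  · rintro ⟨c₀, c, hc₀, hc, rfl⟩
    obtain ⟨h, hh, h₀, hcf⟩ := hexp c₀ c
    refine (mem_invSL_iff hh).2 fun B hB => forall_subset_range_of_Adm (I := I)
      (P := fun B => (slExt F n).cf B h ∈ invS F n (PIset F n I)) (h₀ ▸ hc₀) (fun x hx => ?_) hB
    rw [hcf x hx]
    exact mul_mem (mul_mem (hc x hx) (hεinv x hx)) (moore_pow_mem_invS _)

lemma eq_zero_of_sum_muiGen_eq_zero {c₀ : SV F n} {c : Fin I.length × Finset ℕ → SV F n}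
    (h : c₀ ⊗ₜ[F] 1 + ∑ x ∈ Adm n I, (c x ⊗ₜ[F] 1) * muiGen F I x = 0) :
    c₀ = 0 ∧ ∀ x ∈ Adm n I, c x = 0 := by
  obtain ⟨ε, hε, hexp⟩ := exists_signs F I
  obtain ⟨a, ha, h₀, hc⟩ := hexp c₀ c
  rw [h, map_zero] at ha
  obtain rfl : a = 0 := muiTheta_bijective.1 (ha.trans (map_zero _).symm)
  simp only [map_zero] at h₀ hc
  refine ⟨h₀.symm, fun x hx => ?_⟩
  have hε0 : ε x ≠ 0 := by
    rcases hε x hx with h | h <;> simp [h]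
  have hm := pow_ne_zero (Fintype.card F - 1) (moore_ne_zero F n (I.sizeUpTo_le (x.1 + 1)))
  exact (mul_eq_zero.1 ((mul_eq_zero.1 (hc x hx).symm).resolve_right hm)).resolve_right hε0

end Basis

/-- **Theorem A / Theorem 3.1(1)** (Wan–Wang). `(S(V) ⊗ Λ(V))^{P_I}` is a free
`S(V)^{P_I}`-module of rank `2^n`, with basis `1` together with the elements
`M_{m_i;b_1,…,b_j} θ_1^{q-2} ⋯ θ_i^{q-2}` for `1 ≤ i ≤ ℓ`, `1 ≤ j ≤ m_i`,
`0 ≤ b_1 < ⋯ < b_j ≤ m_i − 1` with `b_j ≥ m_{i-1}`. -/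
theorem parabolic_invariants_free_basis
    (F : Type) [Field F] [Fintype F] (p r q n : ℕ)
    (hp : p.Prime) (hr : 0 < r) (hq : q = p ^ r) (hF : Fintype.card F = q)
    (I : Composition n) :
    (1 + (Adm n I).card = 2 ^ n)
    ∧ (∀ f : SL F n, f ∈ invSL F n (PIset F n I) ↔
        ∃ c₀ : SV F n, ∃ c : Fin I.length × Finset ℕ → SV F n,
          c₀ ∈ invS F n (PIset F n I) ∧
          (∀ x ∈ Adm n I, c x ∈ invS F n (PIset F n I)) ∧
          f = c₀ ⊗ₜ[F] 1 + ∑ x ∈ Adm n I, (c x ⊗ₜ[F] 1) *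
            (MuiM F q n (I.sizeUpTo ((x.1 : ℕ) + 1)) x.2 *
              ((∏ i' : Fin I.length,
                theta F n I i' ^ (if i' ≤ x.1 then q - 2 else 0)) ⊗ₜ[F] 1)))
    ∧ (∀ c₀ : SV F n, ∀ c : Fin I.length × Finset ℕ → SV F n,
        c₀ ∈ invS F n (PIset F n I) →
        (∀ x ∈ Adm n I, c x ∈ invS F n (PIset F n I)) →
        c₀ ⊗ₜ[F] 1 + ∑ x ∈ Adm n I, (c x ⊗ₜ[F] 1) *
          (MuiM F q n (I.sizeUpTo ((x.1 : ℕ) + 1)) x.2 *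
            ((∏ i' : Fin I.length,
              theta F n I i' ^ (if i' ≤ x.1 then q - 2 else 0)) ⊗ₜ[F] 1)) = 0 →
        c₀ = 0 ∧ ∀ x ∈ Adm n I, c x = 0) := by
  subst hF
  exact ⟨card_Adm, mem_invSL_iff_exists, fun _ _ _ _ h => eq_zero_of_sum_muiGen_eq_zero h⟩
end
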